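/- For all integers m, a, b ≥ 0 and n > r ≥ 1 with n ≥ r + a and n + m ≥ b, the (area, bounce) q,t-enumerators of decorated Dyck paths with decorated falls satisfy the recursion DDb_{q,t}(m,n∖r)^{∗b,∘a} = t^{n−r−a} Σ_{j=0}^{m} Σ_{s=0}^{r} q^{binom(s,2)} qbinom(r,s)_q qbinom(r+j−1,j)_q · t^{m−j} Σ_{u=0}^{n−r−a} Σ_{v=0}^{s+j} q^{binom(v,2)} qbinom(s+j,v)_q qbinom(s+j+u−1,u)_q · DDb_{q,t}(m−j, (n−r)∖(u+v))^{∗(b−(r−s)), ∘(a−v)}, where binom(s,2) = s(s−1)/2. -/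

import Mathlib

open Finset

attribute [local instance] Classical.propDecidable

noncomputable section

/-- The ring of polynomials in the two variables `q` and `t` with integer coefficients. -/
abbrev R2 : Type := MvPolynomial (Fin 2) ℤ

/-- The variable `q`. -/
def qv : R2 := MvPolynomial.X 0

/-- The variable `t`. -/
def tv : R2 := MvPolynomial.X 1

/-- The Gaussian binomial coefficient `[N choose k]_q`, defined via the q-Pascal
recursion `[N+1, k+1]_q = [N, k]_q + q^(k+1) [N, k+1]_q`; it agrees with
`[N]_q! / ([k]_q! [N-k]_q!)` for `0 ≤ k ≤ N` and vanishes for `k > N`. -/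
def qBinom : ℕ → ℕ → R2
  | _, 0 => 1
  | 0, _ + 1 => 0
  | N + 1, k + 1 => qBinom N k + qv ^ (k + 1) * qBinom N (k + 1)

/-- The Gaussian binomial coefficient with integer arguments:
it is `0` unless `0 ≤ k ≤ N`. -/
def qBinomZ (N k : ℤ) : R2 :=
  if 0 ≤ k ∧ k ≤ N then qBinom N.toNat k.toNat else 0

/-! ## Dyck paths as step words

A lattice path is encoded as a word `w : Fin L → Bool`, where `true` is a north
step and `false` is an east step. -/

/-- The number of north steps among the first `k` steps. -/
def nBef {L : ℕ} (w : Fin L → Bool) (k : ℕ) : ℕ :=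
  (univ.filter fun i : Fin L => i.1 < k ∧ w i = true).card

/-- The number of east steps among the first `k` steps. -/
def eBef {L : ℕ} (w : Fin L → Bool) (k : ℕ) : ℕ :=
  (univ.filter fun i : Fin L => i.1 < k ∧ w i = false).card

/-- `w` is the step word of a Dyck path of size `N`: it has `N` north steps
(hence `N` east steps) and every prefix has at least as many norths as easts,
i.e. the path stays weakly above the main diagonal. -/
def IsDyckStep (N : ℕ) (w : Fin (2 * N) → Bool) : Prop :=
  nBef w (2 * N) = N ∧ ∀ k : ℕ, k ≤ 2 * N → eBef w k ≤ nBef w k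

/-- A valley: a north step directly preceded by an east step. -/
def IsValleyS {L : ℕ} (w : Fin L → Bool) (i : Fin L) : Prop :=
  w i = true ∧ ∃ j : Fin L, i.1 = j.1 + 1 ∧ w j = false

/-- A peak: a north step followed by an east step, or the last (north) step. -/
def IsPeakS {L : ℕ} (w : Fin L → Bool) (i : Fin L) : Prop :=
  w i = true ∧ ∀ j : Fin L, j.1 = i.1 + 1 → w j = false

/-- A fall: an east step immediately followed by another east step. -/
def IsFallS {L : ℕ} (w : Fin L → Bool) (i : Fin L) : Prop :=
  w i = false ∧ ∃ j : Fin L, j.1 = i.1 + 1 ∧ w j = false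

/-- A fall, where additionally the last step of the path is allowed. -/
def IsFallX {L : ℕ} (w : Fin L → Bool) (i : Fin L) : Prop :=
  w i = false ∧ (i.1 + 1 = L ∨ ∃ j : Fin L, j.1 = i.1 + 1 ∧ w j = false)

/-! ## The bounce statistic for Dyck paths with zero valleys

Every zero valley (its north step together with the east step immediately
preceding it) is replaced by a diagonal step; the modified path has exactly one
east or diagonal step in each column.  The bounce path starts at the origin
travelling north; when it reaches the beginning of the east/diagonal step of
the path in its current column it travels east/diagonally, parallel to the
steps of the path in the columns it traverses, until it reaches the main
diagonal, where it turns north again. -/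

/-- Column `c` of the modified path carries a diagonal step: the east step of
column `c` is immediately followed by a zero valley. -/
def IsDiagCol {L : ℕ} (w : Fin L → Bool) (Z : Finset (Fin L)) (c : ℕ) : Prop :=
  ∃ i j : Fin L, w i = false ∧ eBef w i.1 = c ∧ j.1 = i.1 + 1 ∧ j ∈ Z

/-- The rise (`0` or `1`) of the modified path’s step in column `c`. -/
def diagStep {L : ℕ} (w : Fin L → Bool) (Z : Finset (Fin L)) (c : ℕ) : ℕ :=
  if IsDiagCol w Z c then 1 else 0

/-- The height of the beginning of the east/diagonal step of the path in
column `c` (the number of north steps before the `(c+1)`-st east step). -/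
def colY {L : ℕ} (w : Fin L → Bool) (c : ℕ) : ℕ :=
  (univ.filter fun i : Fin L => w i = true ∧ eBef w i.1 ≤ c).card

/-- The height of the bounce ball, having last touched the diagonal in column
`d`, upon reaching the vertical line `x = c`. -/
def bH {L : ℕ} (w : Fin L → Bool) (Z : Finset (Fin L)) (d c : ℕ) : ℕ :=
  colY w d + ∑ x ∈ Finset.Ico d c, diagStep w Z x

/-- The column of the next point where the bounce path touches the main
diagonal, having last touched it in column `d` (for an actual Dyck path the
bounce path reaches the corner in column `N`, so the clause `c = N` only makes
the function stabilize at `N`). -/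
def nextTouch (N : ℕ) {L : ℕ} (w : Fin L → Bool) (Z : Finset (Fin L)) (d : ℕ) : ℕ :=
  sInf {c : ℕ | (d < c ∧ bH w Z d c = c) ∨ c = N}

/-- The column of the `k`-th touching point of the bounce path with the main
diagonal. -/
def touchPt (N : ℕ) {L : ℕ} (w : Fin L → Bool) (Z : Finset (Fin L)) : ℕ → ℕ
  | 0 => 0
  | k + 1 => nextTouch N w Z (touchPt N w Z k)

/-- The letter of the bounce word carried by the vertical-or-diagonal bounce
step at height `h`: the number of diagonal touches up to that height. -/
def bLabel (N : ℕ) {L : ℕ} (w : Fin L → Bool) (Z : Finset (Fin L)) (h : ℕ) : ℕ :=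
  ((Finset.Icc 1 N).filter fun k => touchPt N w Z k ≤ h).card

/-- The height, upon reaching the vertical line `x = c`, of the path traced
east from (the top of) the north step `p`, parallel to the bounce path. -/
def traceH {L : ℕ} (w : Fin L → Bool) (Z : Finset (Fin L)) (p : Fin L) (c : ℕ) : ℕ :=
  (nBef w p.1 + 1) + ∑ x ∈ Finset.Ico (eBef w p.1) c, diagStep w Z x

/-- The index (height) of the bounce-word letter cancelled by the decorated
peak `p`: the trace from `p` travels east, parallel to the bounce path, until
it first hits a vertical run of the bounce path, at the end of a
vertical-or-diagonal bounce step. -/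
def cancelIdx (N : ℕ) {L : ℕ} (w : Fin L → Bool) (Z : Finset (Fin L)) (p : Fin L) : ℕ :=
  traceH w Z p
      (sInf {d : ℕ | eBef w p.1 ≤ d ∧ (∃ k ≤ N, touchPt N w Z k = d) ∧
        d ≤ traceH w Z p d ∧ traceH w Z p d ≤ colY w d}) - 1

/-- The bounce statistic: the sum of the letters of the bounce word whose
indices are not cancelled by a decorated peak in `P`. -/
def bounceS (N : ℕ) {L : ℕ} (w : Fin L → Bool) (Z P : Finset (Fin L)) : ℕ :=
  ∑ h ∈ (Finset.range N).filter (fun h => h ∉ P.image (cancelIdx N w Z)), bLabel N w Z h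

/-! ## The set `DDb(m, n∖r)^{∗b, ∘a}` -/

/-- Candidate objects: (step word, zero valleys, decorated peaks, decorated falls). -/
abbrev DDbCand (N : ℕ) :=
  (Fin (2 * N) → Bool) × Finset (Fin (2 * N)) × Finset (Fin (2 * N)) × Finset (Fin (2 * N))

/-- Membership in `DDb(m, n∖r)^{∗b, ∘a}`: a Dyck path of size `m+n` with `m`
zero valleys, `a` decorated peaks (which are not zero valleys, and the
leftmost peak is never decorated), `b` decorated falls (the last step of the
path being allowed as a decorated fall), starting with exactly `r` north steps
followed by an east step. -/
def IsDDb (m n r b a : ℕ) (x : DDbCand (m + n)) : Prop :=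
  IsDyckStep (m + n) x.1 ∧
    (∀ i ∈ x.2.1, IsValleyS x.1 i) ∧ x.2.1.card = m ∧
    (∀ i ∈ x.2.2.1, IsPeakS x.1 i) ∧ x.2.2.1.card = a ∧
    Disjoint x.2.2.1 x.2.1 ∧
    (∀ i ∈ x.2.2.1, ∃ j : Fin (2 * (m + n)), IsPeakS x.1 j ∧ j.1 < i.1) ∧
    (∀ i ∈ x.2.2.2, IsFallX x.1 i) ∧ x.2.2.2.card = b ∧
    (∀ i : Fin (2 * (m + n)), i.1 < r → x.1 i = true) ∧
    (∀ i : Fin (2 * (m + n)), i.1 = r → x.1 i = false)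

/-- The area: the number of whole squares between the path and the main
diagonal not lying in a column of a decorated fall (the column of the east
step `i` contains `nBef - eBef - 1` such squares). -/
def areaDDb {N : ℕ} (x : DDbCand N) : ℕ :=
  ∑ i ∈ univ.filter (fun i => x.1 i = false ∧ i ∉ x.2.2.2),
    (nBef x.1 i.1 - eBef x.1 i.1 - 1)

/-- The bounce statistic of a decorated path. -/
def bounceDDb {N : ℕ} (x : DDbCand N) : ℕ := bounceS N x.1 x.2.1 x.2.2.1

/-- The `(area, bounce)` q,t-enumerator `DDb_{q,t}(m, n∖r)^{∗b, ∘a}`;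
it is `0` if some parameter is negative. -/
def DDbE (m n r b a : ℤ) : R2 :=
  if 0 ≤ m ∧ 0 ≤ n ∧ 0 ≤ r ∧ 0 ≤ b ∧ 0 ≤ a then
    ∑ x ∈ univ.filter (IsDDb m.toNat n.toNat r.toNat b.toNat a.toNat),
      qv ^ areaDDb x * tv ^ bounceDDb x
  else 0

/-! ## Gaussian binomial coefficients -/

lemma qBinom_zero_right (N : ℕ) : qBinom N 0 = 1 := by cases N <;> rfl

lemma qBinom_succ_succ (N k : ℕ) :
    qBinom (N + 1) (k + 1) = qBinom N k + qv ^ (k + 1) * qBinom N (k + 1) := rfl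

lemma qBinom_eq_zero_of_lt {N k : ℕ} (h : N < k) : qBinom N k = 0 := by
  induction N generalizing k with
  | zero => obtain ⟨k, rfl⟩ := Nat.exists_eq_succ_of_ne_zero h.ne'; rfl
  | succ N ih =>
    obtain ⟨k, rfl⟩ := Nat.exists_eq_succ_of_ne_zero (by omega : k ≠ 0)
    rw [Nat.succ_eq_add_one, qBinom_succ_succ, ih (by omega), ih (by omega)]
    ring

lemma qBinom_self (N : ℕ) : qBinom N N = 1 := by
  induction N with
  | zero => rfl
  | succ N ih => rw [qBinom_succ_succ, ih, qBinom_eq_zero_of_lt (Nat.lt_succ_self N)]; ring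

/-- The second `q`-Pascal recursion. -/
lemma qBinom_succ_succ' (N k : ℕ) :
    qBinom (N + 1) (k + 1) = qv ^ (N - k) * qBinom N k + qBinom N (k + 1) := by
  induction N generalizing k with
  | zero =>
    cases k with
    | zero => simp [qBinom]
    | succ k => simp [qBinom]
  | succ N ih =>
    cases k with
    | zero =>
      rw [qBinom_succ_succ, ih 0, qBinom_zero_right, qBinom_zero_right, Nat.sub_zero, Nat.sub_zero]
      have := qBinom_succ_succ N 0
      rw [ih 0, qBinom_zero_right, Nat.sub_zero] at this
      linear_combination -this
    | succ k =>
      rw [qBinom_succ_succ (N + 1), ih k, ih (k + 1), Nat.add_sub_add_right]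
      have h2 := qBinom_succ_succ N k
      have h3 := qBinom_succ_succ N (k + 1)
      rw [ih k] at h2
      rw [ih (k + 1)] at h3
      rcases Nat.lt_or_ge k N with h | h
      · obtain ⟨d, rfl⟩ := Nat.exists_eq_add_of_lt h
        have e1 : k + d + 1 - k = d + 1 := by omega
        have e2 : k + d + 1 - (k + 1) = d := by omega
        rw [e1] at h2 ⊢
        rw [e2] at h3 ⊢
        linear_combination -qv ^ (d + 1) * h2 - h3
      · rw [qBinom_eq_zero_of_lt (by omega : N < k + 1),
          qBinom_eq_zero_of_lt (by omega : N < k + 1 + 1), Nat.sub_eq_zero_of_le h]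
        ring

/-- The `q`-multiset coefficient `[e + j - 1, j]_q`, with the convention `[-1, 0]_q = 1`. -/
def qMulti : ℕ → ℕ → R2
  | 0, 0 => 1
  | 0, _ + 1 => 0
  | e + 1, j => qBinom (e + j) j

lemma qMulti_zero_right (e : ℕ) : qMulti e 0 = 1 := by
  cases e with
  | zero => rfl
  | succ e => exact qBinom_zero_right _

lemma qMulti_succ_succ (e j : ℕ) :
    qMulti (e + 1) (j + 1) = qMulti e (j + 1) + qv ^ e * qMulti (e + 1) j := by
  cases e with
  | zero => simp [qMulti, qBinom_self]
  | succ e =>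
    have h := qBinom_succ_succ' (e + 1 + j) j
    rw [Nat.add_sub_cancel] at h
    have h1 : e + (j + 1) = e + 1 + j := by omega
    simp only [qMulti]
    rw [← add_assoc, h, h1]
    ring

/-- The generating function of the `s`-element subsets of `e` slots of weights
`1, q, …, q^(e-1)`. -/
def qSubset (e s : ℕ) : R2 := qv ^ (s * (s - 1) / 2) * qBinom e s

lemma qSubset_zero_right (e : ℕ) : qSubset e 0 = 1 := by
  simp [qSubset, qBinom_zero_right]

lemma qSubset_succ_succ (e s : ℕ) :
    qSubset (e + 1) (s + 1) = qSubset e (s + 1) + qv ^ e * qSubset e s := by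
  have h2 : (s + 1) * (s + 1 - 1) / 2 = s * (s - 1) / 2 + s := by
    rw [← Nat.triangle_succ]
  unfold qSubset
  rw [qBinom_succ_succ', h2]
  rcases Nat.lt_or_ge e s with h | h
  · rw [qBinom_eq_zero_of_lt h]; ring
  · obtain ⟨d, rfl⟩ := Nat.exists_eq_add_of_le h
    rw [Nat.add_sub_cancel_left]
    ring

/-- The generating function of the ways of choosing `s` of `e` slots without repetition and `j` of
them with repetition, the slots having weights `1, q, …, q^(e-1)`. -/
def slotGF (e j s : ℕ) : R2 := qSubset e s * qMulti e j

lemma slotGF_zero (j s : ℕ) : slotGF 0 j s = if j = 0 ∧ s = 0 then 1 else 0 := by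
  cases j <;> cases s <;> simp [slotGF, qSubset, qMulti, qBinom]

lemma slotGF_succ (e j s : ℕ) :
    slotGF (e + 1) j s = slotGF e j s + qv ^ e * (if s = 0 then 0 else slotGF e j (s - 1)) +
      qv ^ e * (if j = 0 then 0 else slotGF (e + 1) (j - 1) s) := by
  have hP : qSubset (e + 1) s =
      qSubset e s + qv ^ e * (if s = 0 then 0 else qSubset e (s - 1)) := by
    cases s <;> simp [qSubset_zero_right, qSubset_succ_succ]
  have hM : qMulti (e + 1) j =
      qMulti e j + qv ^ e * (if j = 0 then 0 else qMulti (e + 1) (j - 1)) := by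
    cases j <;> simp [qMulti_zero_right, qMulti_succ_succ]
  unfold slotGF
  rw [hM, mul_add, hP]
  split_ifs <;> ring

/-- The pairing of `slotGF e` with the restriction of `f` to `[0, M) × [0, M)`. -/
def slotSum (M e : ℕ) (f : ℕ → ℕ → R2) : R2 :=
  ∑ j ∈ range M, ∑ s ∈ range M, slotGF e j s * f j s

lemma slotSum_zero {M : ℕ} (hM : 0 < M) (f : ℕ → ℕ → R2) : slotSum M 0 f = f 0 0 := by
  simp only [slotSum, slotGF_zero]
  rw [sum_eq_single 0, sum_eq_single 0] <;> simp +contextual [hM.ne']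

lemma sum_range_shift (M : ℕ) (c g : ℕ → R2) (hg : ∀ s, s + 1 = M → c s * g M = 0) :
    ∑ s ∈ range M, (if s = 0 then 0 else c (s - 1)) * g s = ∑ s ∈ range M, c s * g (s + 1) := by
  have h := sum_range_succ' (fun s => (if s = 0 then 0 else c (s - 1)) * g s) M
  have hM : (if M = 0 then 0 else c (M - 1)) * g M = 0 := by
    split_ifs with h0
    · simp
    · exact hg _ (by omega)
  rw [sum_range_succ, hM] at h
  simpa using h

lemma slotSum_succ (M e : ℕ) (f : ℕ → ℕ → R2) (hj : ∀ s, f M s = 0)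
    (hs : ∀ j s, s + 1 = M → slotGF e j s * f j M = 0) :
    slotSum M (e + 1) f = slotSum M e f + qv ^ e * slotSum M e (fun j s => f j (s + 1)) +
      qv ^ e * slotSum M (e + 1) (fun j s => f (j + 1) s) := by
  have h1 : ∑ j ∈ range M, ∑ s ∈ range M, (if s = 0 then 0 else slotGF e j (s - 1)) * f j s =
      slotSum M e (fun j s => f j (s + 1)) :=
    sum_congr rfl fun j _ => sum_range_shift M (slotGF e j) (f j) (hs j)
  have h2 : ∑ j ∈ range M, ∑ s ∈ range M,
      (if j = 0 then 0 else slotGF (e + 1) (j - 1) s) * f j s =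
      slotSum M (e + 1) (fun j s => f (j + 1) s) := by
    rw [sum_comm]
    unfold slotSum
    rw [sum_comm (f := fun j s => slotGF (e + 1) j s * f (j + 1) s)]
    exact sum_congr rfl fun s _ => sum_range_shift M (fun j => slotGF (e + 1) j s)
      (fun j => f j s) fun _ _ => by rw [hj, mul_zero]
  rw [← h1, ← h2]
  simp only [slotSum, mul_sum, ← sum_add_distrib]
  refine sum_congr rfl fun j _ => sum_congr rfl fun s _ => ?_
  rw [slotGF_succ]
  ring

lemma slotGF_eq_zero {e s : ℕ} (h : e < s) (j : ℕ) : slotGF e j s = 0 := by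
  simp [slotGF, qSubset, qBinom_eq_zero_of_lt h]

lemma slotSum_congr (M e : ℕ) {f g : ℕ → ℕ → R2} (h : ∀ j s, f j s = g j s) :
    slotSum M e f = slotSum M e g :=
  sum_congr rfl fun j _ => sum_congr rfl fun s _ => by rw [h]

lemma slotSum_eq_zero (M e : ℕ) {f : ℕ → ℕ → R2} (h : ∀ j s, f j s = 0) : slotSum M e f = 0 :=
  sum_eq_zero fun j _ => sum_eq_zero fun s _ => by rw [h, mul_zero]

lemma mul_slotSum (M e : ℕ) (c : R2) (f : ℕ → ℕ → R2) :
    c * slotSum M e f = slotSum M e fun j s => c * f j s := by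
  simp only [slotSum, mul_sum]
  exact sum_congr rfl fun j _ => sum_congr rfl fun s _ => by ring

lemma slotSum_add (M e : ℕ) (f g : ℕ → ℕ → R2) :
    slotSum M e f + slotSum M e g = slotSum M e fun j s => f j s + g j s := by
  simp only [slotSum, mul_add, sum_add_distrib]

/-! ## Decorated words and their weights -/

/-- The steps of a decorated path: undecorated north steps, decorated peaks, zero valleys,
undecorated east steps and decorated falls. -/
inductive Letter
  | north | peak | zero | east | fall

namespace Letter

instance : Fintype Letter where
  elems := {north, peak, zero, east, fall}
  complete x := by cases x <;> simp

/-- The steps that are allowed to follow a given step. -/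
def Follows : Letter → Letter → Prop
  | north, x => x ≠ zero
  | zero, x => x ≠ zero
  | east, _ => True
  | peak, x => x = east ∨ x = fall
  | fall, x => x = east ∨ x = fall

end Letter

open Letter

/-- The weight of a suffix of a decorated path. Here `p` is the step before it, `k` the number of
touching points of the bounce path before the current column, `e` the number of columns without
diagonal step up to the next touching point, `h` the current height above the diagonal, and
`m, n, b, a` are the numbers of zero valleys, other north steps, decorated falls and decorated
peaks to come. -/
def wordWeight : List Letter → Letter → ℕ → ℕ → ℕ → ℤ → ℤ → ℤ → ℤ → R2
  | [], _, _, _, h, m, n, b, a => if h = 0 ∧ m = 0 ∧ n = 0 ∧ b = 0 ∧ a = 0 then 1 else 0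
  | x :: l, p, k, e, h, m, n, b, a =>
    if Follows p x then
      match x with
      | north => tv ^ k * wordWeight l north k e (h + 1) m (n - 1) b a
      | peak => wordWeight l peak k e (h + 1) m (n - 1) b (a - 1)
      | zero => tv ^ (k - 1) * wordWeight l zero k (e + 1) (h + 1) (m - 1) n b a
      | east =>
        if h = 0 then 0
        else qv ^ (h - 1) * wordWeight l east (if e = 0 then k + 1 else k)
          ((if e = 0 then h else e) - 1) (h - 1) m n b a
      | fall =>
        if h = 0 then 0
        else wordWeight l fall (if e = 0 then k + 1 else k)
          ((if e = 0 then h else e) - 1) (h - 1) m n (b - 1) a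
    else 0

/-- The sum of the weights of all suffixes of length `L`. -/
def wordSum (L : ℕ) (p : Letter) (k e h : ℕ) (m n b a : ℤ) : R2 :=
  ∑ y : Fin L → Letter, wordWeight (List.ofFn y) p k e h m n b a

lemma sum_letter (f : Letter → R2) :
    ∑ x, f x = f north + f peak + f zero + f east + f fall := by
  change ∑ x ∈ {north, peak, zero, east, fall}, f x = _
  simp [add_assoc]

lemma sum_fin_cons {L : ℕ} (f : List Letter → R2) :
    ∑ y : Fin (L + 1) → Letter, f (List.ofFn y) =
      ∑ x : Letter, ∑ y : Fin L → Letter, f (x :: List.ofFn y) := by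
  rw [← Fintype.sum_prod_type']
  refine (Fintype.sum_equiv (Fin.consEquiv fun _ => Letter) _ _ ?_).symm
  rintro ⟨x, y⟩
  simp [Fin.consEquiv]

lemma wordSum_zero (p : Letter) (k e h : ℕ) (m n b a : ℤ) :
    wordSum 0 p k e h m n b a = if h = 0 ∧ m = 0 ∧ n = 0 ∧ b = 0 ∧ a = 0 then 1 else 0 := by
  simp [wordSum, wordWeight]

lemma wordSum_succ (L : ℕ) (p : Letter) (k e h : ℕ) (m n b a : ℤ) :
    wordSum (L + 1) p k e h m n b a =
      (if Follows p north then tv ^ k * wordSum L north k e (h + 1) m (n - 1) b a else 0) +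
      (if Follows p peak then wordSum L peak k e (h + 1) m (n - 1) b (a - 1) else 0) +
      (if Follows p zero then tv ^ (k - 1) * wordSum L zero k (e + 1) (h + 1) (m - 1) n b a
        else 0) +
      (if Follows p east then if h = 0 then 0 else qv ^ (h - 1) * wordSum L east
        (if e = 0 then k + 1 else k) ((if e = 0 then h else e) - 1) (h - 1) m n b a else 0) +
      (if Follows p fall then if h = 0 then 0 else wordSum L fall
        (if e = 0 then k + 1 else k) ((if e = 0 then h else e) - 1) (h - 1) m n (b - 1) a
        else 0) := by
  rw [wordSum, sum_fin_cons fun l => wordWeight l p k e h m n b a, sum_letter]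
  simp only [wordSum, wordWeight, mul_sum]
  congr 1 <;> [congr 1 <;> [congr 1 <;> [congr 1; skip]; skip]; skip]
  all_goals split_ifs <;> simp

lemma wordSum_congr_prev (L : ℕ) {p p' : Letter} (hp : Follows p = Follows p')
    (k e h : ℕ) (m n b a : ℤ) :
    wordSum L p k e h m n b a = wordSum L p' k e h m n b a := by
  cases L with
  | zero => rw [wordSum_zero, wordSum_zero]
  | succ L => rw [wordSum_succ, wordSum_succ, hp]

lemma wordSum_eq_zero (L : ℕ) (p : Letter) (k e h : ℕ) (m n b a : ℤ)
    (hneg : m < 0 ∨ b < 0 ∨ a < 0 ∨ n < a) : wordSum L p k e h m n b a = 0 := by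
  induction L generalizing p k e h m n b a with
  | zero => rw [wordSum_zero, if_neg (by omega)]
  | succ L ih =>
    rw [wordSum_succ, ih north _ _ _ _ _ _ _ (by omega), ih peak _ _ _ _ _ _ _ (by omega),
      ih zero _ _ _ _ _ _ _ (by omega), ih east _ _ _ _ _ _ _ (by omega),
      ih fall _ _ _ _ _ _ _ (by omega)]
    simp

/-- Shifting the bounce labels by one multiplies the weight by one factor `tv` for every zero
valley and every undecorated north step. -/
lemma wordSum_succ_label (L : ℕ) (p : Letter) (k e h : ℕ) (m n b a : ℤ) (hk : 1 ≤ k) :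
    wordSum L p (k + 1) e h m n b a =
      tv ^ (n - a + m).toNat * wordSum L p k e h m n b a := by
  induction L generalizing p k e h m n b a with
  | zero =>
    rw [wordSum_zero, wordSum_zero]
    split_ifs with hc
    · obtain ⟨-, rfl, rfl, -, rfl⟩ := hc
      simp
    · simp
  | succ L ih =>
    by_cases hneg : m < 0 ∨ b < 0 ∨ a < 0 ∨ n < a
    · rw [wordSum_eq_zero _ _ _ _ _ _ _ _ _ hneg, wordSum_eq_zero _ _ _ _ _ _ _ _ _ hneg,
        mul_zero]
    have hc : (if e = 0 then k + 1 + 1 else k + 1) = (if e = 0 then k + 1 else k) + 1 := by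
      split_ifs <;> rfl
    have hc1 : 1 ≤ (if e = 0 then k + 1 else k) := by split_ifs <;> omega
    rw [wordSum_succ, wordSum_succ, hc, ih north k _ _ _ _ _ _ hk, ih peak k _ _ _ _ _ _ hk,
      ih zero k _ _ _ _ _ _ hk, ih east _ _ _ _ _ _ _ hc1, ih fall _ _ _ _ _ _ _ hc1]
    have h1 : tv ^ (k + 1) * (tv ^ (n - 1 - a + m).toNat *
        wordSum L north k e (h + 1) m (n - 1) b a) = tv ^ (n - a + m).toNat *
        (tv ^ k * wordSum L north k e (h + 1) m (n - 1) b a) := by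
      by_cases hn : n - 1 < a
      · rw [wordSum_eq_zero _ _ _ _ _ _ _ _ _ (by omega)]; simp
      · rw [show (n - a + m).toNat = (n - 1 - a + m).toNat + 1 by omega]; ring
    have h2 : tv ^ (k + 1 - 1) * (tv ^ (n - a + (m - 1)).toNat *
        wordSum L zero k (e + 1) (h + 1) (m - 1) n b a) = tv ^ (n - a + m).toNat *
        (tv ^ (k - 1) * wordSum L zero k (e + 1) (h + 1) (m - 1) n b a) := by
      by_cases hn : m - 1 < 0
      · rw [wordSum_eq_zero _ _ _ _ _ _ _ _ _ (by omega)]; simp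
      · obtain ⟨k, rfl⟩ := Nat.exists_eq_add_of_le' hk
        rw [show (n - a + m).toNat = (n - a + (m - 1)).toNat + 1 by omega,
          Nat.add_sub_cancel, Nat.add_sub_cancel]
        ring
    have h3 : n - 1 - (a - 1) + m = n - a + m := by ring
    rw [h1, h2, h3]
    split_ifs <;> ring

lemma wordSum_peak_touch (L : ℕ) (k e : ℕ) (m n b a : ℤ) (he : 1 ≤ e) :
    wordSum L peak k 0 e m n b a = wordSum L peak (k + 1) e e m n b a := by
  cases L with
  | zero => rw [wordSum_zero, wordSum_zero]
  | succ L =>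
    rw [wordSum_succ, wordSum_succ]
    have : e ≠ 0 := by omega
    simp [Follows, this]

/-! ## Removing the first bounce -/

/-- The sum of the weights of the suffixes that start at the first touching point, `k` being the
height above the diagonal there. -/
def touchSum (k : ℕ) (m n b a : ℤ) : R2 :=
  wordSum ((k : ℤ) + 2 * (m + n)).toNat peak 1 0 k m n b a

lemma touchSum_eq_zero (k : ℕ) {m n b a : ℤ} (h : m < 0 ∨ b < 0 ∨ a < 0 ∨ n < a) :
    touchSum k m n b a = 0 :=
  wordSum_eq_zero _ _ _ _ _ _ _ _ _ h

/-- The sum over the ways of inserting north steps, decorated or not, at `L` places. -/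
def runSum (M L k : ℕ) (m n b a : ℤ) : R2 :=
  slotSum M L fun u v => tv ^ u * touchSum (k + u + v) m (n - u - v) b (a - v)

lemma runSum_eq_zero (M L k : ℕ) {m n b a : ℤ} (h : m < 0 ∨ n < 0) :
    runSum M L k m n b a = 0 :=
  slotSum_eq_zero _ _ fun u v => by rw [touchSum_eq_zero _ (by omega), mul_zero]

lemma runSum_zero {M : ℕ} (hM : 0 < M) (k : ℕ) (m n b a : ℤ) :
    runSum M 0 k m n b a = touchSum k m n b a := by
  simp [runSum, slotSum_zero hM]

lemma runSum_succ (M L k : ℕ) (m n b a : ℤ) (hn : n < M) :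
    runSum M (L + 1) k m n b a = runSum M L k m n b a +
      qv ^ L * runSum M L (k + 1) m (n - 1) b (a - 1) +
      qv ^ L * (tv * runSum M (L + 1) (k + 1) m (n - 1) b a) := by
  have h1 : (slotSum M L fun u v => tv ^ u *
      touchSum (k + u + (v + 1)) m (n - u - ((v + 1 : ℕ) : ℤ)) b (a - ((v + 1 : ℕ) : ℤ))) =
      runSum M L (k + 1) m (n - 1) b (a - 1) := by
    refine slotSum_congr _ _ fun u v => ?_
    rw [show k + u + (v + 1) = k + 1 + u + v by ring,
      show n - u - ((v + 1 : ℕ) : ℤ) = n - 1 - u - v by push_cast; ring,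
      show a - ((v + 1 : ℕ) : ℤ) = a - 1 - v by push_cast; ring]
  have h2 : (slotSum M (L + 1) fun u v => tv ^ (u + 1) *
      touchSum (k + (u + 1) + v) m (n - ((u + 1 : ℕ) : ℤ) - v) b (a - v)) =
      tv * runSum M (L + 1) (k + 1) m (n - 1) b a := by
    rw [runSum, mul_slotSum]
    refine slotSum_congr _ _ fun u v => ?_
    rw [show k + (u + 1) + v = k + 1 + u + v by ring,
      show n - ((u + 1 : ℕ) : ℤ) - v = n - 1 - u - v by push_cast; ring, pow_succ', mul_assoc]
  rw [← h1, ← h2]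
  refine slotSum_succ M L
    (fun u v => tv ^ u * touchSum (k + u + v) m (n - u - v) b (a - v)) ?_ ?_
  · intro v
    rw [touchSum_eq_zero _ (by omega), mul_zero]
  · intro u _ _
    rw [touchSum_eq_zero _ (by omega), mul_zero, mul_zero]

/-- The sum over the ways of completing a bounce: `e` is the number of east steps before the next
touching point, `k` the number of north steps read since the last one, and `d = 1` if a north
step is allowed to follow at once. -/
def bounceSum (M d e k : ℕ) (m n b a : ℤ) : R2 :=
  slotSum M e fun j s => qv ^ (k * (s + j)) * runSum M (s + j + d) k (m - j) n (b - e + s) a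

lemma bounceSum_eq_zero (M d e k : ℕ) {m n b a : ℤ} (h : m < 0 ∨ n < 0) :
    bounceSum M d e k m n b a = 0 :=
  slotSum_eq_zero _ _ fun j s => by rw [runSum_eq_zero _ _ _ (by omega), mul_zero]

lemma bounceSum_zero {M : ℕ} (hM : 0 < M) (k : ℕ) (m n b a : ℤ) :
    bounceSum M 0 0 k m n b a = touchSum k m n b a := by
  simp [bounceSum, slotSum_zero hM, runSum_zero hM]

lemma bounceSum_one (M e k : ℕ) (m n b a : ℤ) (hn : n < M) :
    bounceSum M 1 e k m n b a = tv * bounceSum M 1 e (k + 1) m (n - 1) b a +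
      bounceSum M 0 e (k + 1) m (n - 1) b (a - 1) + bounceSum M 0 e k m n b a := by
  unfold bounceSum
  rw [mul_slotSum, slotSum_add, slotSum_add]
  refine slotSum_congr _ _ fun j s => ?_
  rw [runSum_succ _ _ _ _ _ _ _ hn, show (k + 1) * (s + j) = k * (s + j) + (s + j) by ring, pow_add]
  simp only [add_zero]
  ring

lemma bounceSum_succ (M e k : ℕ) (m n b a : ℤ) (hm : m < M) (he : e + 1 < M) :
    bounceSum M 0 (e + 1) k m n b a = bounceSum M 0 e k m n (b - 1) a +
      qv ^ (e + k) * bounceSum M 1 e k m n b a +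
      qv ^ (e + k) * bounceSum M 1 (e + 1) k (m - 1) n b a := by
  have h0 : (slotSum M e fun j s => qv ^ (k * (s + j)) *
      runSum M (s + j + 0) k (m - j) n (b - ((e + 1 : ℕ) : ℤ) + s) a) =
      bounceSum M 0 e k m n (b - 1) a := by
    refine slotSum_congr _ _ fun j s => ?_
    rw [show b - ((e + 1 : ℕ) : ℤ) + s = b - 1 - e + s by push_cast; ring]
  have h1 : (slotSum M e fun j s => qv ^ (k * (s + 1 + j)) *
      runSum M (s + 1 + j + 0) k (m - j) n (b - ((e + 1 : ℕ) : ℤ) + ((s + 1 : ℕ) : ℤ)) a) =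
      qv ^ k * bounceSum M 1 e k m n b a := by
    rw [bounceSum, mul_slotSum]
    refine slotSum_congr _ _ fun j s => ?_
    rw [show b - ((e + 1 : ℕ) : ℤ) + ((s + 1 : ℕ) : ℤ) = b - e + s by push_cast; ring,
      show s + 1 + j + 0 = s + j + 1 by ring,
      show k * (s + 1 + j) = k + k * (s + j) by ring, pow_add, mul_assoc]
  have h2 : (slotSum M (e + 1) fun j s => qv ^ (k * (s + (j + 1))) *
      runSum M (s + (j + 1) + 0) k (m - ((j + 1 : ℕ) : ℤ)) n (b - ((e + 1 : ℕ) : ℤ) + s) a) =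
      qv ^ k * bounceSum M 1 (e + 1) k (m - 1) n b a := by
    rw [bounceSum, mul_slotSum]
    refine slotSum_congr _ _ fun j s => ?_
    rw [show m - ((j + 1 : ℕ) : ℤ) = m - 1 - j by push_cast; ring,
      show s + (j + 1) + 0 = s + j + 1 by ring,
      show k * (s + (j + 1)) = k + k * (s + j) by ring, pow_add, mul_assoc]
  rw [pow_add, mul_assoc, mul_assoc, ← h0, ← h1, ← h2]
  refine slotSum_succ M e (fun j s => qv ^ (k * (s + j)) *
    runSum M (s + j + 0) k (m - j) n (b - ((e + 1 : ℕ) : ℤ) + s) a) ?_ ?_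
  · intro s
    rw [runSum_eq_zero _ _ _ (by omega), mul_zero]
  · intro j s hs
    rw [slotGF_eq_zero (by omega), zero_mul]

lemma wordSum_north (L k e h : ℕ) (m n b a : ℤ) :
    wordSum (L + 1) north k e h m n b a = tv ^ k * wordSum L north k e (h + 1) m (n - 1) b a +
      wordSum L peak k e (h + 1) m (n - 1) b (a - 1) + wordSum (L + 1) peak k e h m n b a := by
  rw [wordSum_succ, wordSum_succ L peak]
  simp [Follows]
  ring

lemma wordSum_east (L k e h : ℕ) (m n b a : ℤ) :
    wordSum (L + 1) east k e h m n b a = wordSum (L + 1) north k e h m n b a +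
      tv ^ (k - 1) * wordSum L north k (e + 1) (h + 1) (m - 1) n b a := by
  rw [wordSum_succ, wordSum_succ L north, wordSum_congr_prev L (p := zero) (p' := north) rfl]
  simp [Follows]
  ring

lemma wordSum_peak_succ (L k e h : ℕ) (m n b a : ℤ) :
    wordSum (L + 1) peak k (e + 1) (h + 1) m n b a = qv ^ h * wordSum L east k e h m n b a +
      wordSum L peak k e h m n (b - 1) a := by
  rw [wordSum_succ, wordSum_congr_prev L (p := fall) (p' := peak) rfl]
  simp [Follows]

lemma wordSum_eq_bounceSum (M L e k : ℕ) (m n b a : ℤ) (hL : (L : ℤ) = e + k + 2 * (m + n))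
    (hk : 1 ≤ k + n) (hm : m < M) (hn : n < M) (he : e + 1 < M) :
    wordSum L peak 1 e (e + k) m n b a = bounceSum M 0 e k m n b a ∧
      wordSum L north 1 e (e + k) m n b a = bounceSum M 1 e k m n b a := by
  induction L using Nat.strong_induction_on generalizing e k m n b a with
  | _ L ih =>
  by_cases hneg : m < 0 ∨ n < 0
  · rw [bounceSum_eq_zero _ _ _ _ hneg, bounceSum_eq_zero _ _ _ _ hneg,
      wordSum_eq_zero _ _ _ _ _ _ _ _ _ (by omega), wordSum_eq_zero _ _ _ _ _ _ _ _ _ (by omega)]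
    exact ⟨rfl, rfl⟩
  obtain ⟨L, rfl⟩ : ∃ L', L = L' + 1 := ⟨L - 1, by omega⟩
  have hpeak : wordSum (L + 1) peak 1 e (e + k) m n b a = bounceSum M 0 e k m n b a := by
    cases e with
    | zero =>
      rw [bounceSum_zero (by omega), touchSum, show ((k : ℤ) + 2 * (m + n)).toNat = L + 1 by omega,
        Nat.zero_add]
    | succ e =>
      obtain ⟨L, rfl⟩ : ∃ L', L = L' + 1 := ⟨L - 1, by omega⟩
      rw [show e + 1 + k = e + k + 1 by ring, wordSum_peak_succ, wordSum_east,
        show e + k + 1 = e + 1 + k by ring, bounceSum_succ _ _ _ _ _ _ _ hm (by omega),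
        (ih (L + 1) (by omega) e k m n (b - 1) a (by omega) hk hm hn (by omega)).1,
        (ih (L + 1) (by omega) e k m n b a (by omega) hk hm hn (by omega)).2,
        (ih L (by omega) (e + 1) k (m - 1) n b a (by omega) hk (by omega) hn he).2]
      simp only [Nat.sub_self, pow_zero]
      ring
  refine ⟨hpeak, ?_⟩
  rw [wordSum_north, hpeak, bounceSum_one _ _ _ _ _ _ _ hn, add_assoc e k 1,
    (ih L (by omega) e (k + 1) m (n - 1) b (a - 1) (by omega) (by omega) hm (by omega) he).1,
    (ih L (by omega) e (k + 1) m (n - 1) b a (by omega) (by omega) hm (by omega) he).2, pow_one]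

/-! ## Counting steps -/

section Steps

variable {L : ℕ} (w : Fin L → Bool)

lemma card_filter_lt_succ (P : Fin L → Prop) (i : Fin L) :
    (univ.filter fun j : Fin L => j.1 < i.1 + 1 ∧ P j).card =
      (univ.filter fun j : Fin L => j.1 < i.1 ∧ P j).card + if P i then 1 else 0 := by
  have h : (univ.filter fun j : Fin L => j.1 < i.1 + 1 ∧ P j) =
      (univ.filter fun j : Fin L => j.1 < i.1 ∧ P j) ∪ if P i then {i} else ∅ := by
    ext j
    split_ifs with hi <;> simp only [mem_filter, mem_univ, true_and, mem_union, mem_singleton,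
      notMem_empty, Fin.ext_iff] <;> grind
  rw [h, card_union_of_disjoint]
  · split_ifs <;> simp
  · split_ifs <;> simp

lemma nBef_zero : nBef w 0 = 0 := by simp [nBef]

lemma eBef_zero : eBef w 0 = 0 := by simp [eBef]

lemma nBef_succ (i : Fin L) : nBef w (i.1 + 1) = nBef w i.1 + if w i = true then 1 else 0 := by
  unfold nBef
  convert card_filter_lt_succ (fun j => w j = true) i

lemma eBef_succ (i : Fin L) : eBef w (i.1 + 1) = eBef w i.1 + if w i = false then 1 else 0 := by
  unfold eBef
  convert card_filter_lt_succ (fun j => w j = false) i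

lemma nBef_add_eBef {k : ℕ} (hk : k ≤ L) : nBef w k + eBef w k = k := by
  induction k with
  | zero => rw [nBef_zero, eBef_zero]
  | succ k ih =>
    have h1 := nBef_succ w ⟨k, hk⟩
    have h2 := eBef_succ w ⟨k, hk⟩
    have h3 := ih (by omega)
    cases hw : w ⟨k, hk⟩ <;> simp [hw] at h1 h2 <;> omega

lemma eBef_mono : Monotone (eBef w) := fun _ _ h =>
  card_le_card (monotone_filter_right _ fun _ _ hj => ⟨hj.1.trans_le h, hj.2⟩)

lemma eBef_lt_of_east {i j : Fin L} (hi : w i = false) (h : i.1 < j.1) :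
    eBef w i.1 < eBef w j.1 := by
  have h1 := eBef_succ w i
  rw [if_pos hi] at h1
  have h2 := eBef_mono w (Nat.succ_le_of_lt h)
  rw [Nat.succ_eq_add_one] at h2
  omega

lemma colY_eBef {i : Fin L} (hi : w i = false) : colY w (eBef w i.1) = nBef w i.1 := by
  unfold colY nBef
  congr 1
  ext j
  simp only [mem_filter, mem_univ, true_and]
  constructor
  · rintro ⟨h1, h2⟩
    refine ⟨?_, h1⟩
    by_contra h3
    rcases Nat.lt_or_ge i.1 j.1 with h | h
    · have := eBef_lt_of_east w hi h
      omega
    · have : j = i := Fin.ext (by omega)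
      rw [this, hi] at h1
      cases h1
  · rintro ⟨h1, h2⟩
    exact ⟨h2, eBef_mono w h1.le⟩

lemma exists_east {d : ℕ} (hd : d < eBef w L) : ∃ i : Fin L, w i = false ∧ eBef w i.1 = d := by
  have hex : ∃ k, d < eBef w k := ⟨L, hd⟩
  have h1 := Nat.find_spec hex
  have h2 : Nat.find hex ≤ L := Nat.find_min' hex hd
  obtain ⟨k, hk⟩ : ∃ k, Nat.find hex = k + 1 := by
    refine Nat.exists_eq_succ_of_ne_zero fun h0 => ?_
    rw [h0, eBef_zero] at h1
    omega
  have h3 := Nat.find_min hex (m := k) (by omega)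
  rw [hk] at h1 h2
  have h4 := eBef_succ w ⟨k, h2⟩
  refine ⟨⟨k, h2⟩, ?_, ?_⟩ <;> cases hw : w ⟨k, h2⟩ <;> simp [hw] at h4 ⊢ <;> omega

variable {w} {Z : Finset (Fin L)}

lemma diagStep_eq_card (hZ : ∀ i ∈ Z, IsValleyS w i) (c : ℕ) :
    diagStep w Z c = (Z.filter fun p => eBef w p.1 = c + 1).card := by
  have key : ∀ p ∈ Z, eBef w p.1 = c + 1 →
      ∃ j : Fin L, p.1 = j.1 + 1 ∧ w j = false ∧ eBef w j.1 = c := by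
    intro p hp hc
    obtain ⟨-, j, hj, hwj⟩ := hZ p hp
    have := eBef_succ w j
    rw [if_pos hwj, ← hj] at this
    exact ⟨j, hj, hwj, by omega⟩
  unfold diagStep
  split_ifs with h
  · obtain ⟨i, j, hi, hc, hj, hjZ⟩ := h
    symm
    rw [card_eq_one]
    refine ⟨j, eq_singleton_iff_unique_mem.2 ⟨?_, ?_⟩⟩
    · rw [mem_filter, hj, eBef_succ, if_pos hi, hc]
      exact ⟨hjZ, rfl⟩
    · intro p hp
      rw [mem_filter] at hp
      obtain ⟨i', hp', hi', hc'⟩ := key p hp.1 hp.2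
      have : i' = i := by
        by_contra hne
        rcases lt_or_gt_of_ne (fun h => hne (Fin.ext h)) with hlt | hlt
        · have := eBef_lt_of_east w hi' hlt; omega
        · have := eBef_lt_of_east w hi hlt; omega
      exact Fin.ext (by rw [hp', this, hj])
  · symm
    rw [card_eq_zero, filter_eq_empty_iff]
    intro p hp hc
    obtain ⟨i, hi, hwi, hci⟩ := key p hp hc
    exact h ⟨i, p, hwi, hci, hi, hp⟩

lemma sum_diagStep (hZ : ∀ i ∈ Z, IsValleyS w i) (c d : ℕ) :
    ∑ x ∈ Ico c d, diagStep w Z x = (Z.filter fun p => c < eBef w p.1 ∧ eBef w p.1 ≤ d).card := by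
  rw [card_eq_sum_card_fiberwise (f := fun p => eBef w p.1 - 1) (t := Ico c d)]
  · refine sum_congr rfl fun x hx => ?_
    rw [mem_Ico] at hx
    rw [diagStep_eq_card hZ, filter_filter]
    congr 1
    refine filter_congr fun p _ => ?_
    omega
  · intro p hp
    simp only [coe_filter, Set.mem_ofPred_eq] at hp
    simp only [coe_Ico, Set.mem_Ico]
    omega

lemma bH_eq (hZ : ∀ i ∈ Z, IsValleyS w i) (d c : ℕ) :
    bH w Z d c = colY w d + (Z.filter fun p => d < eBef w p.1 ∧ eBef w p.1 ≤ c).card := by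
  rw [bH, sum_diagStep hZ]

lemma diagStep_le_one (c : ℕ) : diagStep w Z c ≤ 1 := by
  unfold diagStep; split_ifs <;> omega

lemma bH_self (d : ℕ) : bH w Z d d = colY w d := by simp [bH]

lemma bH_succ {d c : ℕ} (h : d ≤ c) : bH w Z d (c + 1) = bH w Z d c + diagStep w Z c := by
  rw [bH, bH, sum_Ico_succ_top h, add_assoc]

end Steps

/-! ## Touching points of the bounce path -/

section Touch

variable {N : ℕ} {w : Fin (2 * N) → Bool} {Z : Finset (Fin (2 * N))}

lemma eBef_two_mul (hw : IsDyckStep N w) : eBef w (2 * N) = N := by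
  have := nBef_add_eBef w (le_refl (2 * N))
  have := hw.1
  omega

lemma lt_colY (hw : IsDyckStep N w) {d : ℕ} (hd : d < N) : d < colY w d := by
  obtain ⟨i, hi, rfl⟩ := exists_east w (d := d) (by rwa [eBef_two_mul hw])
  rw [colY_eBef w hi]
  have h1 := hw.2 (i.1 + 1) (by omega)
  rw [nBef_succ, eBef_succ, if_pos hi, hi] at h1
  simpa using h1

lemma card_north (hw : IsDyckStep N w) : (univ.filter fun i => w i = true).card = N := by
  refine Eq.trans ?_ hw.1
  rw [nBef]
  congr 1
  ext i
  simp

lemma bH_le (hw : IsDyckStep N w) (hZ : ∀ i ∈ Z, IsValleyS w i) (d c : ℕ) :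
    bH w Z d c ≤ N := by
  rw [bH_eq hZ, colY, ← card_union_of_disjoint]
  · refine le_of_le_of_eq ?_ (card_north hw)
    refine card_le_card fun p hp => ?_
    rw [mem_union, mem_filter, mem_filter] at hp
    rw [mem_filter]
    exact ⟨mem_univ _, hp.elim (fun h => h.2.1) fun h => (hZ p h.1).1⟩
  · refine disjoint_left.2 fun p hp hp' => ?_
    rw [mem_filter] at hp hp'
    omega

lemma colY_le (hw : IsDyckStep N w) (d : ℕ) : colY w d ≤ N :=
  le_of_le_of_eq (card_le_card (monotone_filter_right _ fun _ _ h => h.1)) (card_north hw)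

lemma nextTouch_le (d : ℕ) : nextTouch N w Z d ≤ N :=
  Nat.sInf_le (Or.inr rfl)

lemma lt_nextTouch {d : ℕ} (hd : d < N) : d < nextTouch N w Z d := by
  have h : nextTouch N w Z d ∈ {c : ℕ | (d < c ∧ bH w Z d c = c) ∨ c = N} :=
    Nat.sInf_mem ⟨N, Or.inr rfl⟩
  rcases h with h | h
  · exact h.1
  · rwa [h]

lemma lt_bH (hw : IsDyckStep N w) {d c : ℕ} (hdc : d ≤ c)
    (hc : c < nextTouch N w Z d) : c < bH w Z d c := by
  induction c, hdc using Nat.le_induction with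
  | base =>
    rw [bH_self]
    exact lt_colY hw (hc.trans_le (nextTouch_le d))
  | succ c hdc ih =>
    have h1 := ih (by omega)
    have h2 : bH w Z d (c + 1) ≠ c + 1 := fun h =>
      Nat.notMem_of_lt_sInf hc (Or.inl ⟨by omega, h⟩)
    have h3 := bH_succ (w := w) (Z := Z) hdc
    omega

lemma bH_nextTouch (hw : IsDyckStep N w) (hZ : ∀ i ∈ Z, IsValleyS w i) {d : ℕ} (hd : d < N) :
    bH w Z d (nextTouch N w Z d) = nextTouch N w Z d := by
  have hlt := lt_nextTouch (w := w) (Z := Z) hd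
  obtain ⟨c, hc⟩ : ∃ c, nextTouch N w Z d = c + 1 := ⟨nextTouch N w Z d - 1, by omega⟩
  have h1 := lt_bH hw (show d ≤ c by omega) (show c < nextTouch N w Z d by omega)
  have h2 := bH_succ (w := w) (Z := Z) (show d ≤ c by omega)
  have h : nextTouch N w Z d ∈ {c : ℕ | (d < c ∧ bH w Z d c = c) ∨ c = N} :=
    Nat.sInf_mem ⟨N, Or.inr rfl⟩
  rcases h with h | h
  · exact h.2
  · have := bH_le hw hZ d (nextTouch N w Z d)
    rw [hc] at h this ⊢
    omega

lemma diagStep_nextTouch (hw : IsDyckStep N w) (hZ : ∀ i ∈ Z, IsValleyS w i) {d : ℕ} (hd : d < N) :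
    diagStep w Z (nextTouch N w Z d - 1) = 0 := by
  have hlt := lt_nextTouch (w := w) (Z := Z) hd
  obtain ⟨c, hc⟩ : ∃ c, nextTouch N w Z d = c + 1 := ⟨nextTouch N w Z d - 1, by omega⟩
  have h1 := lt_bH hw (show d ≤ c by omega) (show c < nextTouch N w Z d by omega)
  have h2 := bH_succ (w := w) (Z := Z) (show d ≤ c by omega)
  have h3 := bH_nextTouch hw hZ hd
  rw [hc] at h3 ⊢
  rw [Nat.add_sub_cancel]
  omega

lemma colY_le_nextTouch (hw : IsDyckStep N w) (hZ : ∀ i ∈ Z, IsValleyS w i) {d : ℕ} (hd : d < N) :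
    colY w d ≤ nextTouch N w Z d := by
  rw [← bH_nextTouch hw hZ hd, bH]
  omega

lemma nextTouch_self : nextTouch N w Z N = N := by
  have h : nextTouch N w Z N ∈ {c : ℕ | (N < c ∧ bH w Z N c = c) ∨ c = N} :=
    Nat.sInf_mem ⟨N, Or.inr rfl⟩
  have := nextTouch_le (N := N) (w := w) (Z := Z) N
  rcases h with h | h
  · omega
  · exact h

lemma touchPt_le (k : ℕ) : touchPt N w Z k ≤ N := by
  cases k with
  | zero => exact Nat.zero_le _
  | succ k => exact nextTouch_le _

lemma touchPt_lt_succ {k : ℕ} (h : touchPt N w Z k < N) :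
    touchPt N w Z k < touchPt N w Z (k + 1) :=
  lt_nextTouch h

lemma touchPt_mono : Monotone (touchPt N w Z) := by
  refine monotone_nat_of_le_succ fun k => ?_
  rcases (touchPt_le (N := N) (w := w) (Z := Z) k).lt_or_eq with h | h
  · exact (touchPt_lt_succ h).le
  · rw [touchPt, h, nextTouch_self]

lemma min_le_touchPt (k : ℕ) : min k N ≤ touchPt N w Z k := by
  induction k with
  | zero => simp
  | succ k ih =>
    rcases (touchPt_le (N := N) (w := w) (Z := Z) k).lt_or_eq with h | h
    · have := touchPt_lt_succ h
      omega
    · rw [touchPt, h, nextTouch_self]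
      omega

lemma touchPt_size : touchPt N w Z N = N :=
  le_antisymm (touchPt_le N) (by simpa using min_le_touchPt (w := w) (Z := Z) N)

/-- The number of touching points before column `c`. -/
def touchIdx (N : ℕ) (w : Fin (2 * N) → Bool) (Z : Finset (Fin (2 * N))) (c : ℕ) : ℕ :=
  ((range N).filter fun k => touchPt N w Z k < c).card

lemma filter_touchPt_lt {c : ℕ} (hc : c ≤ N) :
    (range N).filter (fun k => touchPt N w Z k < c) = range (touchIdx N w Z c) := by
  have hex : ∃ k, c ≤ touchPt N w Z k := ⟨N, by rwa [touchPt_size]⟩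
  have h : (range N).filter (fun k => touchPt N w Z k < c) = range (Nat.find hex) := by
    ext k
    simp only [mem_filter, mem_range]
    constructor
    · rintro ⟨-, h2⟩
      by_contra h3
      have h4 := touchPt_mono (N := N) (w := w) (Z := Z) (not_lt.1 h3)
      have := Nat.find_spec hex
      omega
    · intro hk
      exact ⟨hk.trans_le (Nat.find_min' hex (by rwa [touchPt_size])),
        not_le.1 (Nat.find_min hex hk)⟩
  rw [touchIdx, h, card_range]

lemma lt_touchIdx_iff {c k : ℕ} (hc : c ≤ N) : k < touchIdx N w Z c ↔ touchPt N w Z k < c := by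
  have := Finset.ext_iff.1 (filter_touchPt_lt (w := w) (Z := Z) hc) k
  rw [mem_filter, mem_range, mem_range] at this
  rw [← this, and_iff_right_iff_imp]
  intro h
  by_contra hk
  have h2 := touchPt_mono (N := N) (w := w) (Z := Z) (not_lt.1 hk)
  rw [touchPt_size] at h2
  omega

lemma touchIdx_le (c : ℕ) : touchIdx N w Z c ≤ N :=
  (card_filter_le _ _).trans (card_range N).le

lemma le_touchPt_touchIdx {c : ℕ} (hc : c ≤ N) : c ≤ touchPt N w Z (touchIdx N w Z c) := by
  by_contra h
  exact lt_irrefl _ ((lt_touchIdx_iff hc).2 (not_le.1 h))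

lemma touchIdx_eq {c k : ℕ} (hc : c ≤ touchPt N w Z k) (hk : ∀ l < k, touchPt N w Z l < c) :
    touchIdx N w Z c = k := by
  have hcN := hc.trans (touchPt_le k)
  refine le_antisymm ?_ ?_
  · by_contra h
    have := (lt_touchIdx_iff hcN).1 (not_le.1 h)
    omega
  · cases k with
    | zero => exact Nat.zero_le _
    | succ k => exact (lt_touchIdx_iff hcN).2 (hk k (Nat.lt_succ_self k))

end Touch

/-! ## The bounce statistic as a sum over steps -/

section Bounce

variable {N : ℕ} {w : Fin (2 * N) → Bool} {Z : Finset (Fin (2 * N))}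

lemma eBef_le (hw : IsDyckStep N w) (i : Fin (2 * N)) : eBef w i.1 ≤ N :=
  (eBef_mono w i.2.le).trans (eBef_two_mul hw).le

lemma touchIdx_pos {c : ℕ} (h0 : 0 < c) (hc : c ≤ N) : 0 < touchIdx N w Z c :=
  (lt_touchIdx_iff hc).2 h0

lemma eBef_valley_pos {i : Fin (2 * N)} (hi : IsValleyS w i) : 0 < eBef w i.1 := by
  obtain ⟨-, j, hj, hwj⟩ := hi
  rw [hj, eBef_succ, if_pos hwj]
  omega

lemma size_sub_touchPt (hw : IsDyckStep N w) (hZ : ∀ i ∈ Z, IsValleyS w i) (k : ℕ) :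
    N - touchPt N w Z (k + 1) =
      (univ.filter fun p => (w p = true ∧ p ∉ Z) ∧ touchPt N w Z k < eBef w p.1).card +
      (Z.filter fun p => touchPt N w Z (k + 1) < eBef w p.1).card := by
  rcases (touchPt_le (N := N) (w := w) (Z := Z) k).lt_or_eq with hlt | heq
  · have h1 : colY w (touchPt N w Z k) + (Z.filter fun p => touchPt N w Z k < eBef w p.1 ∧
        eBef w p.1 ≤ touchPt N w Z (k + 1)).card = touchPt N w Z (k + 1) := by
      rw [← bH_eq hZ]
      exact bH_nextTouch hw hZ hlt
    have h2 := card_north hw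
    have h3 := touchPt_lt_succ hlt
    have h4 : (univ.filter fun i => w i = true) =
        (((univ.filter fun i => w i = true ∧ eBef w i.1 ≤ touchPt N w Z k) ∪
        (Z.filter fun p => touchPt N w Z k < eBef w p.1 ∧ eBef w p.1 ≤ touchPt N w Z (k + 1))) ∪
        (univ.filter fun p => (w p = true ∧ p ∉ Z) ∧ touchPt N w Z k < eBef w p.1)) ∪
        (Z.filter fun p => touchPt N w Z (k + 1) < eBef w p.1) := by
      ext i
      have := hZ i
      simp only [mem_union, mem_filter, mem_univ, true_and]
      by_cases hi : i ∈ Z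
      · have := (this hi).1
        simp only [hi, this, true_and, not_true, false_and, and_false, or_false, true_iff]
        omega
      · simp only [hi, false_and, not_false_eq_true, and_true, or_false, ← and_or_left]
        rw [iff_self_and]
        intros
        omega
    rw [h4, card_union_of_disjoint, card_union_of_disjoint, card_union_of_disjoint] at h2
    · change colY w (touchPt N w Z k) + _ + _ + _ = N at h2
      omega
    all_goals
      refine disjoint_left.2 fun p hp hp' => ?_
      simp only [mem_union, mem_filter, mem_univ, true_and] at hp hp'
      grind
  · have h1 : touchPt N w Z (k + 1) = N := by rw [touchPt, heq, nextTouch_self]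
    rw [h1, heq, filter_false_of_mem, filter_false_of_mem]
    · simp
    · intro p _
      have := eBef_le hw p
      omega
    · intro p _
      have := eBef_le hw p
      omega

lemma sum_bLabel (hw : IsDyckStep N w) (hZ : ∀ i ∈ Z, IsValleyS w i) :
    ∑ h ∈ range N, bLabel N w Z h =
      (∑ p ∈ univ.filter (fun p => w p = true ∧ p ∉ Z), touchIdx N w Z (eBef w p.1)) +
      ∑ p ∈ Z, (touchIdx N w Z (eBef w p.1) - 1) := by
  have h1 : ∑ h ∈ range N, bLabel N w Z h = ∑ k ∈ range N, (N - touchPt N w Z (k + 1)) := by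
    simp only [bLabel, card_filter]
    rw [sum_comm, range_eq_Ico, sum_Ico_add' (fun k => N - touchPt N w Z k) 0 N 1]
    refine sum_congr (by ext; simp) fun k _ => ?_
    rw [← card_filter]
    have : (Ico 0 N).filter (fun h => touchPt N w Z k ≤ h) = Ico (touchPt N w Z k) N := by
      ext
      simp
      omega
    rw [this, Nat.card_Ico]
  have h2 : ∀ p ∈ Z, touchIdx N w Z (eBef w p.1) - 1 =
      ((range N).filter fun k => touchPt N w Z (k + 1) < eBef w p.1).card := by
    intro p hp
    have hle := eBef_le hw p
    have := touchIdx_le (N := N) (w := w) (Z := Z) (eBef w p.1)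
    have h3 : ((range N).filter fun k => touchPt N w Z (k + 1) < eBef w p.1) =
        range (touchIdx N w Z (eBef w p.1) - 1) := by
      ext k
      rw [mem_filter, ← lt_touchIdx_iff hle, mem_range, mem_range]
      omega
    rw [h3, card_range]
  rw [h1, sum_congr rfl h2, sum_congr rfl fun k _ => size_sub_touchPt hw hZ k, sum_add_distrib]
  congr 1
  · simp only [touchIdx, card_filter, sum_filter, ite_and]
    rw [sum_comm]
    refine sum_congr rfl fun p _ => ?_
    split_ifs <;> simp
  · simp only [card_filter]
    exact sum_comm

lemma bLabel_eq {h s : ℕ} (hs : s ≤ N) (h1 : touchPt N w Z s ≤ h)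
    (h2 : h < touchPt N w Z (s + 1)) : bLabel N w Z h = s := by
  have : (Icc 1 N).filter (fun k => touchPt N w Z k ≤ h) = Icc 1 s := by
    ext k
    rw [mem_filter, mem_Icc, mem_Icc]
    constructor
    · rintro ⟨h3, h4⟩
      refine ⟨h3.1, ?_⟩
      by_contra h5
      have := touchPt_mono (N := N) (w := w) (Z := Z) (show s + 1 ≤ k by omega)
      omega
    · rintro ⟨h3, h4⟩
      have := touchPt_mono (N := N) (w := w) (Z := Z) h4
      exact ⟨⟨h3, by omega⟩, by omega⟩
  rw [bLabel, this, Nat.card_Icc, Nat.add_sub_cancel]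

/-- The steps between the last touching point before `p` and `p` that raise the trace of `p` above
the bounce path. -/
def traceSteps (N : ℕ) (w : Fin (2 * N) → Bool) (Z : Finset (Fin (2 * N))) (p : Fin (2 * N)) :
    Finset (Fin (2 * N)) :=
  univ.filter fun q => (w q = true ∧ q ∉ Z) ∧ q ≤ p ∧
    touchPt N w Z (touchIdx N w Z (eBef w p.1) - 1) < eBef w q.1

lemma valley_le_of_eBef_le {z p : Fin (2 * N)} (hz : IsValleyS w z) (hp : w p = true)
    (h : eBef w z.1 ≤ eBef w p.1) : z ≤ p := by
  by_contra hlt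
  obtain ⟨-, j, hj, hwj⟩ := hz
  have hpj : p ≠ j := fun h => by rw [h, hwj] at hp; cases hp
  have h1 : p.1 < j.1 := by
    have : p.1 ≠ j.1 := fun h => hpj (Fin.ext h)
    have : p.1 < z.1 := not_le.1 hlt
    omega
  have h2 := eBef_mono w h1.le
  rw [hj, eBef_succ, if_pos hwj] at h
  omega

lemma traceH_touchPt (hw : IsDyckStep N w) (hZ : ∀ i ∈ Z, IsValleyS w i) {p : Fin (2 * N)}
    (hp : w p = true) (hpos : 0 < eBef w p.1) :
    traceH w Z p (touchPt N w Z (touchIdx N w Z (eBef w p.1))) =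
      touchPt N w Z (touchIdx N w Z (eBef w p.1)) + (traceSteps N w Z p).card := by
  have hle := eBef_le hw p
  have h1 := le_touchPt_touchIdx (w := w) (Z := Z) hle
  have h2 := touchIdx_pos (w := w) (Z := Z) hpos hle
  unfold traceSteps
  obtain ⟨s, hs⟩ : ∃ s, touchIdx N w Z (eBef w p.1) = s + 1 :=
    ⟨touchIdx N w Z (eBef w p.1) - 1, by omega⟩
  have h3 : touchPt N w Z s < eBef w p.1 := (lt_touchIdx_iff hle).1 (by omega)
  rw [hs] at h1 ⊢
  rw [Nat.add_sub_cancel]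
  have h4 := bH_nextTouch hw hZ (h3.trans_le hle)
  change bH w Z _ (touchPt N w Z (s + 1)) = touchPt N w Z (s + 1) at h4
  rw [bH_eq hZ] at h4
  have h5 : nBef w p.1 + 1 = (univ.filter fun q => w q = true ∧ q ≤ p).card := by
    have := nBef_succ w p
    rw [if_pos hp] at this
    rw [← this, nBef]
    congr 1
    ext q
    simp only [mem_filter, mem_univ, true_and, Fin.le_def, Nat.lt_succ_iff, and_comm]
  rw [traceH, sum_diagStep hZ, h5, ← card_union_of_disjoint]
  · conv_rhs => rw [← h4]
    rw [colY, ← card_union_of_disjoint, ← card_union_of_disjoint]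
    · congr 1
      ext q
      simp only [mem_union, mem_filter, mem_univ, true_and]
      have hq : q ≤ p → eBef w q.1 ≤ eBef w p.1 := fun h => eBef_mono w h
      have hq' : ¬ q ≤ p → eBef w p.1 ≤ eBef w q.1 := fun h => eBef_mono w (not_le.1 h).le
      by_cases hqZ : q ∈ Z
      · have hn := (hZ q hqZ).1
        have hv := valley_le_of_eBef_le (hZ q hqZ) hp
        simp only [hqZ, hn, true_and, not_true, false_and, or_false]
        grind
      · simp only [hqZ, false_and, or_false, not_false_eq_true, and_true]
        grind
    all_goals
      refine disjoint_left.2 fun q hq hq' => ?_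
      simp only [mem_union, mem_filter, mem_univ, true_and] at hq hq'
      grind
  · refine disjoint_left.2 fun q hq hq' => ?_
    simp only [mem_filter, mem_univ, true_and] at hq hq'
    have := eBef_mono w (Fin.le_def.1 hq.2)
    omega

lemma traceH_le_colY (hZ : ∀ i ∈ Z, IsValleyS w i) {p : Fin (2 * N)}
    (hp : w p = true) {d : ℕ} (hd : eBef w p.1 ≤ d) : traceH w Z p d ≤ colY w d := by
  have h := nBef_succ w p
  rw [if_pos hp] at h
  rw [traceH, sum_diagStep hZ, ← h, nBef, colY, ← card_union_of_disjoint]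
  · refine card_le_card fun q hq => ?_
    simp only [mem_union, mem_filter, mem_univ, true_and] at hq ⊢
    rcases hq with hq | hq
    · exact ⟨hq.2, (eBef_mono w (Nat.lt_succ_iff.1 hq.1)).trans hd⟩
    · exact ⟨(hZ q hq.1).1, hq.2.2⟩
  · refine disjoint_left.2 fun q hq hq' => ?_
    simp only [mem_filter, mem_univ, true_and] at hq hq'
    have := eBef_mono w (Nat.lt_succ_iff.1 hq.1)
    omega

lemma cancelIdx_eq (hw : IsDyckStep N w) (hZ : ∀ i ∈ Z, IsValleyS w i) {p : Fin (2 * N)}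
    (hp : w p = true) (hpos : 0 < eBef w p.1) :
    cancelIdx N w Z p =
      touchPt N w Z (touchIdx N w Z (eBef w p.1)) + (traceSteps N w Z p).card - 1 := by
  have hle := eBef_le hw p
  have h1 := le_touchPt_touchIdx (w := w) (Z := Z) hle
  have h2 := traceH_touchPt hw hZ hp hpos
  have h3 := traceH_le_colY hZ hp h1
  have h4 : sInf {d : ℕ | eBef w p.1 ≤ d ∧ (∃ k ≤ N, touchPt N w Z k = d) ∧
      d ≤ traceH w Z p d ∧ traceH w Z p d ≤ colY w d} =
      touchPt N w Z (touchIdx N w Z (eBef w p.1)) := by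
    refine le_antisymm (Nat.sInf_le ⟨h1, ⟨_, touchIdx_le _, rfl⟩, by omega, h3⟩) ?_
    refine le_csInf ⟨_, h1, ⟨_, touchIdx_le _, rfl⟩, by omega, h3⟩ ?_
    rintro d ⟨hd, ⟨k, -, rfl⟩, -⟩
    refine touchPt_mono ?_
    by_contra hk
    have := (lt_touchIdx_iff hle).1 (not_le.1 hk)
    omega
  rw [cancelIdx, h4, h2]

lemma traceSteps_pos (hw : IsDyckStep N w) {p : Fin (2 * N)} (hp : w p = true) (hpZ : p ∉ Z)
    (hpos : 0 < eBef w p.1) : p ∈ traceSteps N w Z p := by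
  have hle := eBef_le hw p
  have := touchIdx_pos (w := w) (Z := Z) hpos hle
  simp only [traceSteps, mem_filter, mem_univ, true_and, le_refl]
  exact ⟨⟨hp, hpZ⟩, (lt_touchIdx_iff hle).1 (by omega)⟩

lemma cancelIdx_bounds (hw : IsDyckStep N w) (hZ : ∀ i ∈ Z, IsValleyS w i) {p : Fin (2 * N)}
    (hp : w p = true) (hpZ : p ∉ Z) (hpos : 0 < eBef w p.1) :
    cancelIdx N w Z p < N ∧ bLabel N w Z (cancelIdx N w Z p) = touchIdx N w Z (eBef w p.1) := by
  have h0 := cancelIdx_eq hw hZ hp hpos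
  have hle := eBef_le hw p
  have h1 := le_touchPt_touchIdx (w := w) (Z := Z) hle
  have h2 := traceH_touchPt hw hZ hp hpos
  have h3 := traceH_le_colY hZ hp h1
  have h4 : 0 < (traceSteps N w Z p).card := card_pos.2 ⟨p, traceSteps_pos hw hp hpZ hpos⟩
  have h5 := colY_le hw (touchPt N w Z (touchIdx N w Z (eBef w p.1)))
  have h6 := colY_le_nextTouch hw hZ
    (show touchPt N w Z (touchIdx N w Z (eBef w p.1)) < N by omega)
  change _ ≤ touchPt N w Z (touchIdx N w Z (eBef w p.1) + 1) at h6
  exact ⟨by omega, bLabel_eq (touchIdx_le _) (by omega) (by omega)⟩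

lemma cancelIdx_lt (hw : IsDyckStep N w) (hZ : ∀ i ∈ Z, IsValleyS w i) {p p' : Fin (2 * N)}
    (hp : w p = true) (hpZ : p ∉ Z) (hpos : 0 < eBef w p.1) (hp' : w p' = true) (hpZ' : p' ∉ Z)
    (hlt : p < p') (heq : touchIdx N w Z (eBef w p.1) = touchIdx N w Z (eBef w p'.1)) :
    cancelIdx N w Z p < cancelIdx N w Z p' := by
  have hpos' : 0 < eBef w p'.1 := hpos.trans_le (eBef_mono w hlt.le)
  rw [cancelIdx_eq hw hZ hp hpos, cancelIdx_eq hw hZ hp' hpos', heq]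
  have h1 : 0 < (traceSteps N w Z p).card := card_pos.2 ⟨p, traceSteps_pos hw hp hpZ hpos⟩
  have h2 : (traceSteps N w Z p).card < (traceSteps N w Z p').card := by
    refine card_lt_card (ssubset_iff_of_subset ?_ |>.2
      ⟨p', traceSteps_pos hw hp' hpZ' hpos', ?_⟩)
    · intro q hq
      simp only [traceSteps, mem_filter, mem_univ, true_and, heq] at hq ⊢
      exact ⟨hq.1, hq.2.1.trans hlt.le, hq.2.2⟩
    · simp only [traceSteps, mem_filter, not_and]
      exact fun _ _ h => absurd h (not_le.2 hlt)
  omega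

lemma bounceS_eq (hw : IsDyckStep N w) (hZ : ∀ i ∈ Z, IsValleyS w i) {P : Finset (Fin (2 * N))}
    (hP : ∀ p ∈ P, w p = true ∧ p ∉ Z ∧ 0 < eBef w p.1) :
    bounceS N w Z P =
      (∑ p ∈ univ.filter (fun p => w p = true ∧ p ∉ Z ∧ p ∉ P), touchIdx N w Z (eBef w p.1)) +
      ∑ p ∈ Z, (touchIdx N w Z (eBef w p.1) - 1) := by
  have hinj : Set.InjOn (cancelIdx N w Z) P := by
    intro p hp p' hp' heq
    obtain ⟨h1, h2, h3⟩ := hP p hp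
    obtain ⟨h1', h2', h3'⟩ := hP p' hp'
    have hs : touchIdx N w Z (eBef w p.1) = touchIdx N w Z (eBef w p'.1) := by
      rw [← (cancelIdx_bounds hw hZ h1 h2 h3).2, heq, (cancelIdx_bounds hw hZ h1' h2' h3').2]
    rcases lt_trichotomy p p' with h | h | h
    · exact absurd heq (cancelIdx_lt hw hZ h1 h2 h3 h1' h2' h hs).ne
    · exact h
    · exact absurd heq (cancelIdx_lt hw hZ h1' h2' h3' h1 h2 h hs.symm).ne'
  have h1 := sum_bLabel hw hZ
  rw [← sum_filter_add_sum_filter_not (range N) (fun h => h ∉ P.image (cancelIdx N w Z))] at h1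
  have h2 : (range N).filter (fun h => ¬ h ∉ P.image (cancelIdx N w Z)) =
      P.image (cancelIdx N w Z) := by
    ext h
    simp only [not_not, mem_filter, mem_range, and_iff_right_iff_imp]
    intro hh
    obtain ⟨p, hp, rfl⟩ := mem_image.1 hh
    obtain ⟨h1, h2, h3⟩ := hP p hp
    exact (cancelIdx_bounds hw hZ h1 h2 h3).1
  have h3 : ∑ h ∈ P.image (cancelIdx N w Z), bLabel N w Z h =
      ∑ p ∈ P, touchIdx N w Z (eBef w p.1) := by
    rw [sum_image hinj]
    refine sum_congr rfl fun p hp => ?_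
    obtain ⟨h1, h2, h3⟩ := hP p hp
    exact (cancelIdx_bounds hw hZ h1 h2 h3).2
  have h4 : univ.filter (fun p => w p = true ∧ p ∉ Z) =
      univ.filter (fun p => w p = true ∧ p ∉ Z ∧ p ∉ P) ∪ P := by
    ext p
    have := hP p
    simp only [mem_union, mem_filter, mem_univ, true_and]
    tauto
  rw [h2, h3, h4, sum_union] at h1
  · change bounceS N w Z P + _ = _ at h1
    omega
  · refine disjoint_left.2 fun p hp hp' => ?_
    simp only [mem_filter] at hp
    tauto

end Bounce

/-! ## The state of the bounce path along the steps of a path -/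

section State

variable {N : ℕ} {w : Fin (2 * N) → Bool} {Z : Finset (Fin (2 * N))}

/-- The column of the first touching point that is not before the step `i`. -/
def touchCol (N : ℕ) (w : Fin (2 * N) → Bool) (Z : Finset (Fin (2 * N))) (i : ℕ) : ℕ :=
  touchPt N w Z (touchIdx N w Z (eBef w i))

/-- The number of columns without diagonal step from the step `i` to the next touching point. -/
def flatCols (N : ℕ) (w : Fin (2 * N) → Bool) (Z : Finset (Fin (2 * N))) (i : ℕ) : ℕ :=
  touchCol N w Z i - eBef w i -
    (Z.filter fun z => i ≤ z.1 ∧ eBef w z.1 ≤ touchCol N w Z i).card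

lemma eBef_succ_of_north {i : Fin (2 * N)} (hi : w i = true) : eBef w (i.1 + 1) = eBef w i.1 := by
  rw [eBef_succ, if_neg (by simp [hi]), add_zero]

lemma touchCol_eq_of_eBef_eq {i j : ℕ} (h : eBef w i = eBef w j) :
    touchCol N w Z i = touchCol N w Z j := by
  rw [touchCol, h, touchCol]

lemma eBef_le_touchCol (hw : IsDyckStep N w) {i : ℕ} (hi : i ≤ 2 * N) :
    eBef w i ≤ touchCol N w Z i :=
  le_touchPt_touchIdx ((eBef_mono w hi).trans (eBef_two_mul hw).le)

lemma diagStep_touchCol (hw : IsDyckStep N w) (hZ : ∀ i ∈ Z, IsValleyS w i) {i : ℕ}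
    (hi : i ≤ 2 * N) (hpos : 0 < touchCol N w Z i) :
    diagStep w Z (touchCol N w Z i - 1) = 0 := by
  have hle := (eBef_mono w hi).trans (eBef_two_mul hw).le
  rw [touchCol] at hpos ⊢
  obtain ⟨s, hs⟩ : ∃ s, touchIdx N w Z (eBef w i) = s + 1 := by
    refine Nat.exists_eq_succ_of_ne_zero fun h => ?_
    rw [h, touchPt] at hpos
    omega
  rw [hs]
  exact diagStep_nextTouch hw hZ (((lt_touchIdx_iff hle).1 (by omega)).trans_le hle)

lemma eBef_valley_lt (hw : IsDyckStep N w) (hZ : ∀ i ∈ Z, IsValleyS w i) {i : Fin (2 * N)}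
    (hi : i ∈ Z) : eBef w i.1 < touchCol N w Z i.1 := by
  refine lt_of_le_of_ne (eBef_le_touchCol hw i.2.le) fun h => ?_
  have hpos := eBef_valley_pos (hZ i hi)
  have h1 := diagStep_touchCol hw hZ i.2.le (h ▸ hpos)
  rw [← h, diagStep_eq_card hZ, card_eq_zero] at h1
  have : i ∈ Z.filter fun p => eBef w p.1 = eBef w i.1 - 1 + 1 :=
    mem_filter.2 ⟨hi, by omega⟩
  rw [h1] at this
  exact notMem_empty _ this

lemma filter_valley_succ (hZ : ∀ i ∈ Z, IsValleyS w i) (i : Fin (2 * N)) (T : ℕ) :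
    (Z.filter fun z => i.1 + 1 ≤ z.1 ∧ eBef w z.1 ≤ T) =
      Z.filter fun z => eBef w i.1 < eBef w z.1 ∧ eBef w z.1 ≤ T := by
  refine filter_congr fun z hz => and_congr_left fun _ => ⟨fun h => ?_, fun h => ?_⟩
  · obtain ⟨-, j, hj, hwj⟩ := hZ z hz
    have := eBef_mono w (show i.1 ≤ j.1 by omega)
    rw [hj, eBef_succ, if_pos hwj]
    omega
  · by_contra h2
    have := eBef_mono w (show z.1 ≤ i.1 by omega)
    omega

lemma card_valley_lt (hw : IsDyckStep N w) (hZ : ∀ i ∈ Z, IsValleyS w i) {i : Fin (2 * N)}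
    (hlt : eBef w i.1 < touchCol N w Z i.1) :
    (Z.filter fun z => i.1 + 1 ≤ z.1 ∧ eBef w z.1 ≤ touchCol N w Z i.1).card <
      touchCol N w Z i.1 - eBef w i.1 := by
  have h0 := diagStep_touchCol hw hZ i.2.le (by omega)
  rw [filter_valley_succ hZ, ← sum_diagStep hZ]
  generalize touchCol N w Z i.1 = T at *
  obtain ⟨c, rfl⟩ : ∃ c, T = c + 1 := ⟨T - 1, by omega⟩
  rw [Nat.add_sub_cancel] at h0
  rw [sum_Ico_succ_top (by omega), h0]
  have : ∑ x ∈ Ico (eBef w i.1) c, diagStep w Z x ≤ (c - eBef w i.1) * 1 :=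
    (sum_le_card_nsmul _ _ 1 fun x _ => diagStep_le_one x).trans (by simp)
  omega

lemma filter_valley_of_notMem {i : Fin (2 * N)} (hi : i ∉ Z) (T : ℕ) :
    (Z.filter fun z => i.1 ≤ z.1 ∧ eBef w z.1 ≤ T) =
      Z.filter fun z => i.1 + 1 ≤ z.1 ∧ eBef w z.1 ≤ T := by
  refine filter_congr fun z hz => and_congr_left fun _ => ?_
  have : i.1 ≠ z.1 := fun h => hi (Fin.ext h ▸ hz)
  omega

lemma flatCols_north {i : Fin (2 * N)} (hi : w i = true) (hiZ : i ∉ Z) :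
    flatCols N w Z (i.1 + 1) = flatCols N w Z i.1 := by
  have h := eBef_succ_of_north hi
  rw [flatCols, flatCols, touchCol_eq_of_eBef_eq h, h, filter_valley_of_notMem hiZ]

lemma flatCols_zero (hw : IsDyckStep N w) (hZ : ∀ i ∈ Z, IsValleyS w i) {i : Fin (2 * N)}
    (hi : i ∈ Z) : flatCols N w Z (i.1 + 1) = flatCols N w Z i.1 + 1 := by
  have h := eBef_succ_of_north (hZ i hi).1
  have hlt := eBef_valley_lt hw hZ hi
  have h1 := card_valley_lt hw hZ hlt
  rw [flatCols, flatCols, touchCol_eq_of_eBef_eq h, h]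
  have h2 : (Z.filter fun z => i.1 ≤ z.1 ∧ eBef w z.1 ≤ touchCol N w Z i.1) =
      insert i (Z.filter fun z => i.1 + 1 ≤ z.1 ∧ eBef w z.1 ≤ touchCol N w Z i.1) := by
    ext z
    rw [mem_insert, mem_filter, mem_filter]
    rcases eq_or_ne z i with rfl | hne
    · simp [hi, hlt.le]
    · have : z.1 ≠ i.1 := fun h => hne (Fin.ext h)
      simp only [hne, false_or]
      refine and_congr_right fun _ => and_congr_left fun _ => ?_
      omega
  rw [h2, card_insert_of_notMem (by simp)]
  omega

lemma touchIdx_east_lt (hw : IsDyckStep N w) {i : Fin (2 * N)} (hi : w i = false)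
    (hlt : eBef w i.1 < touchCol N w Z i.1) :
    touchIdx N w Z (eBef w (i.1 + 1)) = touchIdx N w Z (eBef w i.1) := by
  have h := eBef_succ w i
  rw [if_pos hi] at h
  refine touchIdx_eq ?_ fun l hl => ?_
  · rw [h]
    exact hlt
  · have := (lt_touchIdx_iff (eBef_le hw i)).1 hl
    omega

lemma flatCols_east_lt (hw : IsDyckStep N w) (hZ : ∀ i ∈ Z, IsValleyS w i) {i : Fin (2 * N)}
    (hi : w i = false) (hlt : eBef w i.1 < touchCol N w Z i.1) :
    flatCols N w Z i.1 = flatCols N w Z (i.1 + 1) + 1 := by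
  have h := eBef_succ w i
  rw [if_pos hi] at h
  have hiZ : i ∉ Z := fun hh => by
    have := (hZ i hh).1
    rw [hi] at this
    cases this
  have h1 := card_valley_lt hw hZ hlt
  have h2 : touchCol N w Z (i.1 + 1) = touchCol N w Z i.1 := by
    rw [touchCol, touchIdx_east_lt hw hi hlt, touchCol]
  rw [flatCols, flatCols, h2, h, filter_valley_of_notMem hiZ]
  omega

lemma flatCols_eq_zero {i : ℕ} (h : eBef w i = touchCol N w Z i) : flatCols N w Z i = 0 := by
  rw [flatCols, ← h]
  omega

lemma touchIdx_east_eq (hw : IsDyckStep N w) {i : Fin (2 * N)} (hi : w i = false)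
    (heq : eBef w i.1 = touchCol N w Z i.1) :
    touchIdx N w Z (eBef w (i.1 + 1)) = touchIdx N w Z (eBef w i.1) + 1 := by
  have h := eBef_succ w i
  rw [if_pos hi] at h
  have hle : eBef w (i.1 + 1) ≤ N :=
    (eBef_mono w (show i.1 + 1 ≤ 2 * N by omega)).trans (eBef_two_mul hw).le
  rw [touchCol] at heq
  refine touchIdx_eq ?_ fun l hl => ?_
  · have := touchPt_lt_succ (w := w) (Z := Z) (k := touchIdx N w Z (eBef w i.1)) (by omega)
    omega
  · have := touchPt_mono (N := N) (w := w) (Z := Z) (Nat.lt_succ_iff.1 hl)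
    omega

lemma flatCols_east_eq (hw : IsDyckStep N w) (hZ : ∀ i ∈ Z, IsValleyS w i) {i : Fin (2 * N)}
    (hi : w i = false) (heq : eBef w i.1 = touchCol N w Z i.1) :
    flatCols N w Z (i.1 + 1) = nBef w i.1 - eBef w i.1 - 1 := by
  have h := eBef_succ w i
  rw [if_pos hi] at h
  have hle : eBef w (i.1 + 1) ≤ N :=
    (eBef_mono w (show i.1 + 1 ≤ 2 * N by omega)).trans (eBef_two_mul hw).le
  have h1 : touchCol N w Z (i.1 + 1) = nextTouch N w Z (eBef w i.1) := by
    rw [touchCol, touchIdx_east_eq hw hi heq, touchPt]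
    exact congrArg _ heq.symm
  have h2 := bH_nextTouch hw hZ (show eBef w i.1 < N by omega)
  rw [bH_eq hZ, colY_eBef w hi] at h2
  rw [flatCols, filter_valley_succ hZ, h1, h]
  omega

end State

/-! ## Words of decorated paths -/

/-- Whether a letter is a north step. -/
def Letter.isNorth : Letter → Bool
  | .north | .peak | .zero => true
  | .east | .fall => false

/-- The decorated path with a given word. -/
def pathOf {N : ℕ} (Y : Fin (2 * N) → Letter) : DDbCand N :=
  (fun i => (Y i).isNorth, univ.filter (fun i => Y i = zero), univ.filter (fun i => Y i = peak),
    univ.filter fun i => Y i = fall)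

/-- The sum of the values of `f` from the position `i` on. -/
def tailSum {L : ℕ} {M : Type*} [AddCommMonoid M] (f : Fin L → M) (i : ℕ) : M :=
  ∑ j ∈ univ.filter (fun j : Fin L => i ≤ j.1), f j

lemma tailSum_eq {L : ℕ} {M : Type*} [AddCommMonoid M] (f : Fin L → M) (i : Fin L) :
    tailSum f i.1 = f i + tailSum f (i.1 + 1) := by
  have h : (univ.filter fun j : Fin L => i.1 ≤ j.1) =
      insert i (univ.filter fun j : Fin L => i.1 + 1 ≤ j.1) := by
    ext j
    simp only [mem_filter, mem_univ, true_and, mem_insert, Fin.ext_iff]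
    omega
  rw [tailSum, h, sum_insert (by simp), tailSum]

lemma tailSum_length {L : ℕ} {M : Type*} [AddCommMonoid M] (f : Fin L → M) : tailSum f L = 0 := by
  rw [tailSum, filter_false_of_mem (fun j _ => not_le.2 j.2), sum_empty]

lemma tailSum_zero {L : ℕ} {M : Type*} [AddCommMonoid M] (f : Fin L → M) :
    tailSum f 0 = ∑ j, f j := by
  simp [tailSum]

lemma drop_ofFn {L : ℕ} (Y : Fin L → Letter) (i : Fin L) :
    (List.ofFn Y).drop i.1 = Y i :: (List.ofFn Y).drop (i.1 + 1) := by
  rw [List.drop_eq_getElem_cons (by simp), List.getElem_ofFn]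

lemma drop_ofFn_length {L : ℕ} (Y : Fin L → Letter) : (List.ofFn Y).drop L = [] :=
  List.drop_eq_nil_of_le (by simp)

/-- The number of occurrences of letters satisfying `S` from the position `i` on. -/
def tailCount {L : ℕ} (Y : Fin L → Letter) (S : Letter → Prop) (i : ℕ) : ℤ :=
  tailSum (fun j => if S (Y j) then 1 else 0) i

/-- The contribution of a step to the area. -/
def areaStep {N : ℕ} (Y : Fin (2 * N) → Letter) (i : Fin (2 * N)) : ℕ :=
  if Y i = east then nBef (pathOf Y).1 i.1 - eBef (pathOf Y).1 i.1 - 1 else 0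

/-- The contribution of a step to the bounce statistic. -/
def bounceStep {N : ℕ} (Y : Fin (2 * N) → Letter) (i : Fin (2 * N)) : ℕ :=
  match Y i with
  | north => touchIdx N (pathOf Y).1 (pathOf Y).2.1 (eBef (pathOf Y).1 i.1)
  | zero => touchIdx N (pathOf Y).1 (pathOf Y).2.1 (eBef (pathOf Y).1 i.1) - 1
  | _ => 0

/-- Consecutive letters are compatible. -/
def FollowsFrom {L : ℕ} (Y : Fin L → Letter) (i : ℕ) : Prop :=
  ∀ j k : Fin L, i ≤ j.1 → k.1 = j.1 + 1 → Follows (Y j) (Y k)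

lemma wordWeight_eq {N : ℕ} {Y : Fin (2 * N) → Letter} (hw : IsDyckStep N (pathOf Y).1)
    (hZ : ∀ i ∈ (pathOf Y).2.1, IsValleyS (pathOf Y).1 i) {i : ℕ} (hi : i ≤ 2 * N)
    (hY : FollowsFrom Y i) {p : Letter} (hp : ∀ j : Fin (2 * N), j.1 = i → Follows p (Y j)) :
    wordWeight ((List.ofFn Y).drop i) p
      (touchIdx N (pathOf Y).1 (pathOf Y).2.1 (eBef (pathOf Y).1 i))
      (flatCols N (pathOf Y).1 (pathOf Y).2.1 i)
      (nBef (pathOf Y).1 i - eBef (pathOf Y).1 i)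
      (tailCount Y (· = zero) i) (tailCount Y (fun x => x = north ∨ x = peak) i)
      (tailCount Y (· = fall) i) (tailCount Y (· = peak) i) =
    qv ^ tailSum (areaStep Y) i * tv ^ tailSum (bounceStep Y) i := by
  induction hn : 2 * N - i generalizing i p with
  | zero =>
    obtain rfl : i = 2 * N := by omega
    rw [drop_ofFn_length]
    simp only [tailCount, tailSum_length, wordWeight, pow_zero, mul_one, and_true, ite_eq_left_iff]
    have h1 := hw.1
    have h2 := eBef_two_mul hw
    omega
  | succ n ih =>
    obtain ⟨i, rfl⟩ : ∃ j : Fin (2 * N), j.1 = i := ⟨⟨i, by omega⟩, rfl⟩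
    have ih := ih (i := i.1 + 1) (p := Y i) (by omega)
      (fun j k hj hk => hY j k (by omega) hk) (fun j hj => hY i j le_rfl hj) (by omega)
    have hf := hp i rfl
    have hle := hw.2 i.1 hi
    have hle' := hw.2 (i.1 + 1) (by omega)
    rw [drop_ofFn, tailSum_eq (areaStep Y), tailSum_eq (bounceStep Y)]
    simp only [tailCount] at ih ⊢
    rw [tailSum_eq _ i, tailSum_eq _ i, tailSum_eq _ i, tailSum_eq _ i]
    have hnorth : (pathOf Y).1 i = (Y i).isNorth := rfl
    have hmem : i ∈ (pathOf Y).2.1 ↔ Y i = zero := by simp [pathOf]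
    have hns := nBef_succ (pathOf Y).1 i
    have hes := eBef_succ (pathOf Y).1 i
    have harea : areaStep Y i = if Y i = east then nBef (pathOf Y).1 i.1 -
      eBef (pathOf Y).1 i.1 - 1 else 0 := rfl
    have hbounce : bounceStep Y i = match Y i with
      | north => touchIdx N (pathOf Y).1 (pathOf Y).2.1 (eBef (pathOf Y).1 i.1)
      | zero => touchIdx N (pathOf Y).1 (pathOf Y).2.1 (eBef (pathOf Y).1 i.1) - 1
      | _ => 0 := rfl
    rw [harea, hbounce]
    have heast : (pathOf Y).1 i = false → flatCols N (pathOf Y).1 (pathOf Y).2.1 (i.1 + 1) =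
        (if flatCols N (pathOf Y).1 (pathOf Y).2.1 i.1 = 0 then
          nBef (pathOf Y).1 i.1 - eBef (pathOf Y).1 i.1 else
          flatCols N (pathOf Y).1 (pathOf Y).2.1 i.1) - 1 ∧
        touchIdx N (pathOf Y).1 (pathOf Y).2.1 (eBef (pathOf Y).1 (i.1 + 1)) =
        if flatCols N (pathOf Y).1 (pathOf Y).2.1 i.1 = 0 then
          touchIdx N (pathOf Y).1 (pathOf Y).2.1 (eBef (pathOf Y).1 i.1) + 1 else
          touchIdx N (pathOf Y).1 (pathOf Y).2.1 (eBef (pathOf Y).1 i.1) := by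
      intro hE
      rcases (eBef_le_touchCol hw (Z := (pathOf Y).2.1) i.2.le).lt_or_eq with hlt | heq
      · have h1 := flatCols_east_lt hw hZ hE hlt
        rw [touchIdx_east_lt hw hE hlt, if_neg (by omega), if_neg (by omega), h1]
        exact ⟨rfl, rfl⟩
      · rw [touchIdx_east_eq hw hE heq, flatCols_east_eq hw hZ hE heq,
          if_pos (flatCols_eq_zero heq), if_pos (flatCols_eq_zero heq)]
        exact ⟨rfl, rfl⟩
    generalize hy : Y i = y at *
    cases y
    case north =>
      have hT : (pathOf Y).1 i = true := hnorth
      rw [if_pos hT] at hns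
      rw [eBef_succ_of_north hT, flatCols_north hT (by simp [hmem]), hns,
        show nBef (pathOf Y).1 i.1 + 1 - eBef (pathOf Y).1 i.1 =
          nBef (pathOf Y).1 i.1 - eBef (pathOf Y).1 i.1 + 1 by omega] at ih
      simp only [wordWeight, if_pos hf, reduceCtorEq, if_false, if_true, true_or, zero_add,
        add_sub_cancel_left, ih]
      ring
    case peak =>
      have hT : (pathOf Y).1 i = true := hnorth
      rw [if_pos hT] at hns
      rw [eBef_succ_of_north hT, flatCols_north hT (by simp [hmem]), hns,
        show nBef (pathOf Y).1 i.1 + 1 - eBef (pathOf Y).1 i.1 =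
          nBef (pathOf Y).1 i.1 - eBef (pathOf Y).1 i.1 + 1 by omega] at ih
      simp only [wordWeight, if_pos hf, reduceCtorEq, if_false, if_true, or_true, zero_add,
        add_sub_cancel_left, ih]
    case zero =>
      have hT : (pathOf Y).1 i = true := hnorth
      rw [if_pos hT] at hns
      rw [eBef_succ_of_north hT, flatCols_zero hw hZ (by simp [hmem]), hns,
        show nBef (pathOf Y).1 i.1 + 1 - eBef (pathOf Y).1 i.1 =
          nBef (pathOf Y).1 i.1 - eBef (pathOf Y).1 i.1 + 1 by omega] at ih
      simp only [wordWeight, if_pos hf, reduceCtorEq, if_false, if_true, or_self, zero_add,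
        add_sub_cancel_left, ih]
      ring
    case east =>
      have hE : (pathOf Y).1 i = false := hnorth
      rw [if_neg (by simp [hE]), add_zero] at hns
      rw [if_pos hE] at hes
      obtain ⟨h1, h2⟩ := heast hE
      rw [h1, h2, hns, hes, ← Nat.sub_sub] at ih
      rw [hns, hes] at hle'
      simp only [wordWeight, if_pos hf, reduceCtorEq, if_false, if_true, or_self, zero_add, ih]
      rw [if_neg (by omega)]
      ring
    case fall =>
      have hE : (pathOf Y).1 i = false := hnorth
      rw [if_neg (by simp [hE]), add_zero] at hns
      rw [if_pos hE] at hes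
      obtain ⟨h1, h2⟩ := heast hE
      rw [h1, h2, hns, hes, ← Nat.sub_sub] at ih
      rw [hns, hes] at hle'
      simp only [wordWeight, if_pos hf, reduceCtorEq, if_false, if_true, or_self, zero_add,
        add_sub_cancel_left, ih]
      rw [if_neg (by omega)]

/-! ## Decorated paths correspond to words of nonzero weight -/

lemma of_wordWeight_ne_zero {N : ℕ} {Y : Fin (2 * N) → Letter} {i : ℕ} (hi : i ≤ 2 * N)
    {p : Letter} {k e h : ℕ} {m n b a : ℤ}
    (hne : wordWeight ((List.ofFn Y).drop i) p k e h m n b a ≠ 0) :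
    (∀ j : Fin (2 * N), j.1 = i → Follows p (Y j)) ∧ FollowsFrom Y i ∧
      tailCount Y (· = zero) i = m ∧ tailCount Y (fun x => x = north ∨ x = peak) i = n ∧
      tailCount Y (· = fall) i = b ∧ tailCount Y (· = peak) i = a ∧
      (∀ c, i ≤ c → c ≤ 2 * N → eBef (pathOf Y).1 c + nBef (pathOf Y).1 i ≤
        h + nBef (pathOf Y).1 c + eBef (pathOf Y).1 i) ∧
      eBef (pathOf Y).1 (2 * N) + nBef (pathOf Y).1 i =
        h + nBef (pathOf Y).1 (2 * N) + eBef (pathOf Y).1 i := by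
  induction hn : 2 * N - i generalizing i p k e h m n b a with
  | zero =>
    obtain rfl : i = 2 * N := by omega
    rw [drop_ofFn_length, wordWeight] at hne
    simp only [ne_eq, ite_eq_right_iff, one_ne_zero, imp_false, not_not] at hne
    obtain ⟨rfl, rfl, rfl, rfl, rfl⟩ := hne
    simp only [tailCount, tailSum_length, true_and]
    refine ⟨fun j hj => absurd hj j.2.ne, fun j _ hj => absurd j.2 (not_lt.2 hj), ?_, by omega⟩
    intro c h1 h2
    obtain rfl : c = 2 * N := by omega
    omega
  | succ l ih =>
    obtain ⟨i, rfl⟩ : ∃ j : Fin (2 * N), j.1 = i := ⟨⟨i, by omega⟩, rfl⟩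
    have hw : (pathOf Y).1 i = (Y i).isNorth := rfl
    have hns := nBef_succ (pathOf Y).1 i
    have hes := eBef_succ (pathOf Y).1 i
    have hf : Follows p (Y i) := by
      by_contra hf
      rw [drop_ofFn, wordWeight.eq_def] at hne
      simp only [if_neg hf] at hne
      exact hne rfl
    have key : ∀ {k e h' : ℕ} {m' n' b' a' : ℤ},
        wordWeight ((List.ofFn Y).drop (i.1 + 1)) (Y i) k e h' m' n' b' a' ≠ 0 →
        m = (if Y i = zero then 1 else 0) + m' →
        n = (if Y i = north ∨ Y i = peak then 1 else 0) + n' →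
        b = (if Y i = fall then 1 else 0) + b' →
        a = (if Y i = peak then 1 else 0) + a' →
        h' + eBef (pathOf Y).1 (i.1 + 1) + nBef (pathOf Y).1 i.1 =
          h + nBef (pathOf Y).1 (i.1 + 1) + eBef (pathOf Y).1 i.1 →
        (∀ j : Fin (2 * N), j.1 = i.1 → Follows p (Y j)) ∧ FollowsFrom Y i.1 ∧
          tailCount Y (· = zero) i.1 = m ∧
          tailCount Y (fun x => x = north ∨ x = peak) i.1 = n ∧
          tailCount Y (· = fall) i.1 = b ∧ tailCount Y (· = peak) i.1 = a ∧
          (∀ c, i.1 ≤ c → c ≤ 2 * N → eBef (pathOf Y).1 c + nBef (pathOf Y).1 i.1 ≤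
            h + nBef (pathOf Y).1 c + eBef (pathOf Y).1 i.1) ∧
          eBef (pathOf Y).1 (2 * N) + nBef (pathOf Y).1 i.1 =
            h + nBef (pathOf Y).1 (2 * N) + eBef (pathOf Y).1 i.1 := by
      intro k e h' m' n' b' a' hne hm hn' hb ha hh
      obtain ⟨h1, h2, h3, h4, h5, h6, h7, h8⟩ := ih (i := i.1 + 1) (by omega) hne (by omega)
      simp only [tailCount] at *
      refine ⟨fun j hj => Fin.ext hj ▸ hf, fun j j' hj hj' => ?_, ?_, ?_, ?_, ?_, ?_, by omega⟩
      · rcases hj.eq_or_lt with heq | hlt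
        · obtain rfl : i = j := Fin.ext heq
          exact h1 j' hj'
        · exact h2 j j' hlt hj'
      · rw [tailSum_eq, h3, hm]
      · rw [tailSum_eq, h4, hn']
        congr!
      · rw [tailSum_eq, h5, hb]
      · rw [tailSum_eq, h6, ha]
      · intro c hc hc'
        rcases hc.eq_or_lt with rfl | hlt
        · omega
        · have := h7 c hlt hc'
          omega
    rw [drop_ofFn, wordWeight.eq_def] at hne
    simp only [if_pos hf] at hne
    generalize hy : Y i = y at *
    cases y
    case north =>
      have hT : (pathOf Y).1 i = true := hw
      rw [if_pos hT] at hns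
      have := eBef_succ_of_north hT
      exact key (right_ne_zero_of_mul hne) (by simp) (by simp) (by simp) (by simp) (by omega)
    case peak =>
      have hT : (pathOf Y).1 i = true := hw
      rw [if_pos hT] at hns
      have := eBef_succ_of_north hT
      exact key hne (by simp) (by simp) (by simp) (by simp) (by omega)
    case zero =>
      have hT : (pathOf Y).1 i = true := hw
      rw [if_pos hT] at hns
      have := eBef_succ_of_north hT
      exact key (right_ne_zero_of_mul hne) (by simp) (by simp) (by simp) (by simp) (by omega)
    case east =>
      have hE : (pathOf Y).1 i = false := hw
      rw [if_neg (by simp [hE])] at hns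
      rw [if_pos hE] at hes
      rcases Nat.eq_zero_or_pos h with rfl | hpos
      · simp at hne
      · simp only [hpos.ne', if_false] at hne
        exact key (right_ne_zero_of_mul hne) (by simp) (by simp) (by simp) (by simp) (by omega)
    case fall =>
      have hE : (pathOf Y).1 i = false := hw
      rw [if_neg (by simp [hE])] at hns
      rw [if_pos hE] at hes
      rcases Nat.eq_zero_or_pos h with rfl | hpos
      · simp at hne
      · simp only [hpos.ne', if_false] at hne
        exact key hne (by simp) (by simp) (by simp) (by simp) (by omega)

lemma eBef_eq_zero {L r : ℕ} {w : Fin L → Bool} (h : ∀ i : Fin L, i.1 < r → w i = true) :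
    eBef w r = 0 := by
  rw [eBef, card_eq_zero, filter_eq_empty_iff]
  rintro i - ⟨h1, h2⟩
  rw [h i h1] at h2
  cases h2

lemma tailCount_zero {L : ℕ} (Y : Fin L → Letter) (S : Letter → Prop) :
    tailCount Y S 0 = (univ.filter fun i => S (Y i)).card := by
  rw [tailCount, tailSum_zero, sum_boole]

lemma tailSum_eq_add {L : ℕ} {M : Type*} [AddCommMonoid M] (f : Fin L → M) (r : ℕ) (hr : r ≤ L)
    (c : M) (h : ∀ i : Fin L, i.1 < r → f i = c) : tailSum f 0 = r • c + tailSum f r := by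
  induction r with
  | zero => simp
  | succ r ih =>
    rw [ih (by omega) fun i hi => h i (by omega), tailSum_eq f ⟨r, hr⟩, h ⟨r, hr⟩ (by simp),
      succ_nsmul, add_assoc]

section Paths

variable {m n r b a : ℕ}

lemma r_lt_of_isDDb {x : DDbCand (m + n)} (hx : IsDDb m n r b a x) (hn : 1 ≤ n) :
    1 ≤ r ∧ r < 2 * (m + n) := by
  obtain ⟨hw, -, -, -, -, -, -, -, -, h1, h2⟩ := hx
  constructor
  · by_contra h0
    have h3 := eBef_succ x.1 ⟨0, by omega⟩
    have h4 := nBef_succ x.1 ⟨0, by omega⟩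
    have h5 := h2 ⟨0, by omega⟩ (by simp; omega)
    have h6 := hw.2 1 (by omega)
    rw [if_pos h5, eBef_zero] at h3
    rw [if_neg (by simp [h5]), nBef_zero] at h4
    simp only [zero_add] at h3 h4
    omega
  · by_contra hlt
    have := eBef_eq_zero (w := x.1) (r := 2 * (m + n)) fun i hi => h1 i (by omega)
    have := eBef_two_mul hw
    omega

lemma init_of_isDDb {Y : Fin (2 * (m + n)) → Letter} (hx : IsDDb m n r b a (pathOf Y)) :
    ∀ i : Fin (2 * (m + n)), i.1 < r → Y i = north := by
  obtain ⟨-, hZ, -, -, -, -, hP, -, -, h1, -⟩ := hx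
  intro i hi
  have hT : (Y i).isNorth = true := h1 i hi
  have hnz : Y i ≠ zero := fun h => by
    obtain ⟨-, j, hj, hwj⟩ := hZ i (by simp [pathOf, h])
    rw [h1 j (by omega)] at hwj
    cases hwj
  have hnp : Y i ≠ peak := fun h => by
    obtain ⟨j, hj, hlt⟩ := hP i (by simp [pathOf, h])
    have := hj.2 ⟨j.1 + 1, by omega⟩ rfl
    rw [h1 _ (by simp only; omega)] at this
    cases this
  cases hy : Y i <;> simp_all [isNorth]

lemma followsFrom_of_isDDb {Y : Fin (2 * (m + n)) → Letter} (hx : IsDDb m n r b a (pathOf Y)) :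
    FollowsFrom Y 0 := by
  obtain ⟨-, hZ, -, hP, -, -, -, hF, -, -, -⟩ := hx
  intro j k _ hk
  have hnz : (Y j).isNorth = true → Y k ≠ zero := fun hj h => by
    obtain ⟨-, j', hj', hwj⟩ := hZ k (by simp [pathOf, h])
    obtain rfl : j = j' := Fin.ext (by omega)
    change (Y j).isNorth = false at hwj
    rw [hj] at hwj
    cases hwj
  have hE : (Y k).isNorth = false → Y k = east ∨ Y k = fall := by
    cases Y k <;> simp [isNorth]
  cases hy : Y j
  · exact hnz (by rw [hy]; rfl)
  · exact hE ((hP j (by simp [pathOf, hy])).2 k hk)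
  · exact hnz (by rw [hy]; rfl)
  · trivial
  · rcases (hF j (by simp [pathOf, hy])).2 with h | ⟨k', hk', hwk⟩
    · omega
    · obtain rfl : k = k' := Fin.ext (by omega)
      exact hE hwk

lemma nBef_eq_tailCount {N : ℕ} (Y : Fin (2 * N) → Letter) :
    (nBef (pathOf Y).1 (2 * N) : ℤ) =
      tailCount Y (· = zero) 0 + tailCount Y (fun x => x = north ∨ x = peak) 0 := by
  rw [tailCount_zero, tailCount_zero, nBef, ← Nat.cast_add, ← card_union_of_disjoint]
  · refine congrArg (fun s : Finset (Fin (2 * N)) => (s.card : ℤ)) ?_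
    ext i
    simp only [mem_filter, mem_univ, true_and, mem_union, i.2]
    rw [show (pathOf Y).1 i = (Y i).isNorth from rfl]
    cases Y i <;> simp [isNorth]
  · refine disjoint_left.2 fun i h1 h2 => ?_
    simp only [mem_filter, mem_univ, true_and] at h1 h2
    rw [h1] at h2
    simp at h2

lemma weight_of_isDDb {Y : Fin (2 * (m + n)) → Letter} (hx : IsDDb m n r b a (pathOf Y))
    (hn : 1 ≤ n) :
    r ≤ n ∧ wordWeight ((List.ofFn Y).drop r) peak 0 0 r m (n - r) b a =
      qv ^ areaDDb (pathOf Y) * tv ^ bounceDDb (pathOf Y) := by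
  obtain ⟨hr, hr2⟩ := r_lt_of_isDDb hx hn
  have hinit := init_of_isDDb hx
  have hfol := followsFrom_of_isDDb hx
  obtain ⟨hw, hZ, hm, hP, ha, hPZ, hP', hF, hb, h1, h2⟩ := hx
  have he : eBef (pathOf Y).1 r = 0 := eBef_eq_zero h1
  have hn' : nBef (pathOf Y).1 r = r := by
    have := nBef_add_eBef (pathOf Y).1 hr2.le
    omega
  have hcount : ∀ S : Letter → Prop, tailCount Y S r =
      (univ.filter fun i => S (Y i)).card - r * if S north then 1 else 0 := by
    intro S
    have := tailSum_eq_add (fun j => if S (Y j) then (1 : ℤ) else 0) r hr2.le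
      (if S north then 1 else 0) fun i hi => by rw [hinit i hi]
    rw [← tailCount_zero, tailCount, tailCount, this, nsmul_eq_mul]
    ring
  have hcn : tailCount Y (fun x => x = north ∨ x = peak) 0 = n := by
    have h3 := nBef_eq_tailCount Y
    rw [hw.1, tailCount_zero Y (· = zero)] at h3
    change _ = ((pathOf Y).2.1.card : ℤ) + _ at h3
    rw [hm] at h3
    push_cast at h3
    omega
  have hcn' := hcount fun x => x = north ∨ x = peak
  rw [← tailCount_zero Y fun x => x = north ∨ x = peak, hcn] at hcn'
  have key := wordWeight_eq hw hZ hr2.le (fun j k _ hk => hfol j k (Nat.zero_le _) hk)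
    (p := peak) fun j hj => by
      have : (Y j).isNorth = false := h2 j hj
      change Y j = east ∨ Y j = fall
      cases hy : Y j <;> simp_all [isNorth]
  have htouch : touchIdx (m + n) (pathOf Y).1 (pathOf Y).2.1 0 = 0 :=
    touchIdx_eq (Nat.zero_le _) fun l hl => absurd hl (Nat.not_lt_zero l)
  have hflat : flatCols (m + n) (pathOf Y).1 (pathOf Y).2.1 r = 0 := by
    refine flatCols_eq_zero ?_
    rw [touchCol, he, htouch, touchPt]
  have harea : areaDDb (pathOf Y) = tailSum (areaStep Y) r := by
    have h3 := tailSum_eq_add (areaStep Y) r hr2.le 0 fun i hi => by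
      rw [areaStep, hinit i hi, if_neg (by simp)]
    rw [smul_zero, zero_add, tailSum_zero] at h3
    rw [← h3, areaDDb, sum_filter]
    refine sum_congr rfl fun i _ => ?_
    rw [areaStep]
    refine if_congr ?_ rfl rfl
    simp only [pathOf, mem_filter, mem_univ, true_and]
    cases Y i <;> simp [isNorth]
  have hbounce : bounceDDb (pathOf Y) = tailSum (bounceStep Y) r := by
    have h3 := tailSum_eq_add (bounceStep Y) r hr2.le 0 fun i hi => by
      have h4 : eBef (pathOf Y).1 i.1 = 0 := Nat.eq_zero_of_le_zero (he ▸ eBef_mono _ hi.le)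
      rw [bounceStep, hinit i hi]
      simp only
      rw [h4, htouch]
    rw [smul_zero, zero_add, tailSum_zero] at h3
    rw [← h3, bounceDDb, bounceS_eq hw hZ]
    · rw [sum_filter, show (pathOf Y).2.1 = univ.filter (fun i => i ∈ (pathOf Y).2.1) by simp,
        sum_filter, ← sum_add_distrib]
      refine sum_congr rfl fun i _ => ?_
      have hT : (pathOf Y).1 i = (Y i).isNorth := rfl
      have hz : i ∈ (pathOf Y).2.1 ↔ Y i = zero := by simp [pathOf]
      have hp : i ∈ (pathOf Y).2.2.1 ↔ Y i = peak := by simp [pathOf]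
      rw [bounceStep]
      simp only [filter_mem_eq_inter, univ_inter, hT, hz, hp]
      cases Y i <;> simp [isNorth]
    · intro p hp
      refine ⟨(hP p hp).1, disjoint_left.1 hPZ hp, ?_⟩
      obtain ⟨j, hj, hlt⟩ := hP' p hp
      have h5 := hj.2 ⟨j.1 + 1, by omega⟩ rfl
      have h6 := eBef_succ (pathOf Y).1 ⟨j.1 + 1, by omega⟩
      rw [if_pos h5] at h6
      have h7 : j.1 + 1 ≠ p.1 := fun h => by
        have h8 := (hP p hp).1
        rw [show p = ⟨j.1 + 1, by omega⟩ from Fin.ext h.symm, h5] at h8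
        cases h8
      have h8 := eBef_mono (pathOf Y).1 (show j.1 + 1 + 1 ≤ p.1 by omega)
      simp only at h6
      omega
  rw [he, htouch, hflat, hn', hcount (· = zero), hcount (· = fall), hcount (· = peak),
    hcn', ← harea, ← hbounce] at key
  change wordWeight _ _ _ _ _ (((pathOf Y).2.1.card : ℤ) - _) _
    (((pathOf Y).2.2.2.card : ℤ) - _) (((pathOf Y).2.2.1.card : ℤ) - _) = _ at key
  rw [hm, ha, hb] at key
  refine ⟨?_, by simpa using key⟩
  have h10 : (0 : ℤ) ≤ tailCount Y (fun x => x = north ∨ x = peak) r := by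
    rw [tailCount, tailSum]
    exact sum_nonneg fun i _ => by split_ifs <;> simp
  simp only [true_or, if_true] at hcn'
  omega

lemma isDDb_of_weight {Y : Fin (2 * (m + n)) → Letter} (hr : 1 ≤ r) (hrn : r ≤ n)
    (hinit : ∀ i : Fin (2 * (m + n)), i.1 < r → Y i = north)
    (hne : wordWeight ((List.ofFn Y).drop r) peak 0 0 r m (n - r) b a ≠ 0) :
    IsDDb m n r b a (pathOf Y) := by
  have hr2 : r ≤ 2 * (m + n) := by omega
  obtain ⟨hp, hfol, hm, hn, hb, ha, hdyck, hend⟩ := of_wordWeight_ne_zero hr2 hne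
  have h1 : ∀ i : Fin (2 * (m + n)), i.1 < r → (pathOf Y).1 i = true := fun i hi => by
    simp [pathOf, hinit i hi, isNorth]
  have he : eBef (pathOf Y).1 r = 0 := eBef_eq_zero h1
  have hsum := nBef_add_eBef (pathOf Y).1 hr2
  have hsum' := nBef_add_eBef (pathOf Y).1 (le_refl (2 * (m + n)))
  have hcount : ∀ S : Letter → Prop, ((univ.filter fun i => S (Y i)).card : ℤ) =
      tailCount Y S r + r * if S north then 1 else 0 := by
    intro S
    have := tailSum_eq_add (fun j => if S (Y j) then (1 : ℤ) else 0) r hr2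
      (if S north then 1 else 0) fun i hi => by rw [hinit i hi]
    rw [← tailCount_zero, tailCount, tailCount, this, nsmul_eq_mul]
    ring
  have hfol' : FollowsFrom Y 0 := by
    intro j k _ hk
    rcases lt_or_ge j.1 r with hj | hj
    · rw [hinit j hj]
      change Y k ≠ zero
      rcases lt_or_ge k.1 r with hk' | hk'
      · simp [hinit k hk']
      · rcases hp k (by omega) with h | h <;> simp [h]
    · exact hfol j k hj hk
  have hrlt : r < 2 * (m + n) := by omega
  have hwr : (pathOf Y).1 ⟨r, hrlt⟩ = false := by
    rcases hp ⟨r, hrlt⟩ rfl with h | h <;> simp [pathOf, h, isNorth]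
  have hPk : ∀ i : Fin (2 * (m + n)), Y i = peak → IsPeakS (pathOf Y).1 i := by
    intro i hi
    refine ⟨by simp [pathOf, hi, isNorth], fun j hj => ?_⟩
    have h3 := hfol' i j (Nat.zero_le _) hj
    rw [hi] at h3
    rcases h3 with h | h <;> simp [pathOf, h, isNorth]
  refine ⟨⟨by omega, fun k hk => ?_⟩, ?_, ?_, ?_, ?_, ?_, ?_, ?_, ?_, h1, ?_⟩
  · rcases le_total r k with h | h
    · have := hdyck k h hk
      omega
    · have := eBef_mono (pathOf Y).1 h
      omega
  · intro i hi
    have hi : Y i = zero := by simpa [pathOf] using hi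
    refine ⟨by simp [pathOf, hi, isNorth], ⟨i.1 - 1, by omega⟩, ?_, ?_⟩
    · have : ¬ i.1 < r := fun h => by
        rw [hinit i h] at hi
        cases hi
      simp only
      omega
    · have h2 : ¬ i.1 < r := fun h => by
        rw [hinit i h] at hi
        cases hi
      have h3 := hfol' ⟨i.1 - 1, by omega⟩ i (Nat.zero_le _) (by simp only; omega)
      rw [hi] at h3
      change (Y _).isNorth = false
      cases hy : Y ⟨i.1 - 1, by omega⟩ <;> simp_all [isNorth, Follows]
  · have := hcount (· = zero)
    rw [hm] at this
    simp only [reduceCtorEq, if_false, mul_zero, add_zero] at this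
    exact_mod_cast this
  · intro i hi
    exact hPk i (by simpa [pathOf] using hi)
  · have := hcount (· = peak)
    rw [ha] at this
    simp only [reduceCtorEq, if_false, mul_zero, add_zero] at this
    exact_mod_cast this
  · refine disjoint_left.2 fun i h3 h4 => ?_
    simp only [pathOf, mem_filter] at h3 h4
    rw [h3.2] at h4
    cases h4.2
  · intro i hi
    have hi : Y i = peak := by simpa [pathOf] using hi
    refine ⟨⟨r - 1, by omega⟩, ⟨h1 _ (by simp only; omega), fun j hj => ?_⟩, ?_⟩
    · obtain rfl : j = ⟨r, hrlt⟩ := Fin.ext (by simp only at hj ⊢; omega)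
      exact hwr
    · have : ¬ i.1 < r := fun h => by
        rw [hinit i h] at hi
        cases hi
      simp only
      omega
  · intro i hi
    have hi : Y i = fall := by simpa [pathOf] using hi
    refine ⟨by simp [pathOf, hi, isNorth], ?_⟩
    rcases Nat.lt_or_ge (i.1 + 1) (2 * (m + n)) with hlt | hge
    · right
      refine ⟨⟨i.1 + 1, hlt⟩, rfl, ?_⟩
      have h3 := hfol' i ⟨i.1 + 1, hlt⟩ (Nat.zero_le _) rfl
      rw [hi] at h3
      rcases h3 with h | h <;> simp [pathOf, h, isNorth]
    · left
      omega
  · have := hcount (· = fall)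
    rw [hb] at this
    simp only [reduceCtorEq, if_false, mul_zero, add_zero] at this
    exact_mod_cast this
  · intro i hi
    obtain rfl : i = ⟨r, hrlt⟩ := Fin.ext hi
    exact hwr

end Paths

/-! ## The enumerator as a sum over words -/

lemma sum_word_init (f : List Letter → R2) (r M : ℕ) :
    ∑ Y : Fin (M + r) → Letter,
      (if ∀ i : Fin (M + r), i.1 < r → Y i = north then f ((List.ofFn Y).drop r) else 0) =
      ∑ z : Fin M → Letter, f (List.ofFn z) := by
  induction r with
  | zero => simp
  | succ r ih =>
    rw [← ih]
    change ∑ Y : Fin (M + r + 1) → Letter, _ = _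
    rw [← Fintype.sum_equiv (Fin.consEquiv fun _ => Letter)
      (fun p => if p.1 = north then
        (if ∀ i : Fin (M + r), i.1 < r → p.2 i = north then f ((List.ofFn p.2).drop r) else 0)
        else 0) _ ?_, Fintype.sum_prod_type, Fintype.sum_eq_single north]
    · simp
    · intro x hx
      simp [hx]
    · rintro ⟨x, Y⟩
      rw [← ite_and]
      refine if_congr ?_ ?_ rfl
      · change _ ↔ ∀ i : Fin (M + r + 1), _
        rw [Fin.forall_iff_succ]
        simp [Fin.consEquiv]
      · change _ = f (List.drop (r + 1) (List.ofFn (n := M + r + 1) _))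
        rw [List.ofFn_succ]
        simp [Fin.consEquiv]

lemma pathOf_injective (N : ℕ) : Function.Injective (pathOf (N := N)) := by
  intro Y Y' h
  funext i
  have h1 : (Y i).isNorth = (Y' i).isNorth := congrFun (congrArg (fun x => x.1) h) i
  have h2 : i ∈ (pathOf Y).2.1 ↔ i ∈ (pathOf Y').2.1 := by rw [h]
  have h3 : i ∈ (pathOf Y).2.2.1 ↔ i ∈ (pathOf Y').2.2.1 := by rw [h]
  have h4 : i ∈ (pathOf Y).2.2.2 ↔ i ∈ (pathOf Y').2.2.2 := by rw [h]
  simp only [pathOf, mem_filter, mem_univ, true_and] at h2 h3 h4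
  cases hy : Y i <;> cases hy' : Y' i <;> simp_all [isNorth]

lemma exists_pathOf_eq {m n r b a : ℕ} {x : DDbCand (m + n)} (hx : IsDDb m n r b a x) :
    ∃ Y, pathOf Y = x := by
  obtain ⟨-, hZ, -, hP, -, hPZ, -, hF, -⟩ := hx
  obtain ⟨w, Z, P, F⟩ := x
  refine ⟨fun i => if w i = true then (if i ∈ Z then zero else if i ∈ P then peak else north)
    else if i ∈ F then fall else east, Prod.ext ?_ (Prod.ext ?_ (Prod.ext ?_ ?_))⟩
  · funext i
    simp only [pathOf]
    split_ifs <;> simp_all [isNorth]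
  · ext i
    have := fun h => (hZ i h).1
    simp only [pathOf, mem_filter, mem_univ, true_and]
    split_ifs <;> simp_all
  · ext i
    have := fun h => (hP i h).1
    have := fun h : i ∈ P => disjoint_left.1 hPZ h
    simp only [pathOf, mem_filter, mem_univ, true_and]
    split_ifs <;> simp_all
  · ext i
    have := fun h => (hF i h).1
    simp only [pathOf, mem_filter, mem_univ, true_and]
    split_ifs <;> simp_all

lemma sum_isDDb {m n r b a : ℕ} (hn : 1 ≤ n) (hr : 1 ≤ r) (hrn : r ≤ n) :
    ∑ x ∈ univ.filter (IsDDb m n r b a), qv ^ areaDDb x * tv ^ bounceDDb x =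
      wordSum (2 * (m + n) - r) peak 0 0 r m (n - r) b a := by
  have h1 : ∑ x ∈ univ.filter (IsDDb m n r b a), qv ^ areaDDb x * tv ^ bounceDDb x =
      ∑ Y ∈ univ.filter (fun Y => IsDDb m n r b a (pathOf Y)),
        qv ^ areaDDb (pathOf Y) * tv ^ bounceDDb (pathOf Y) := by
    symm
    refine sum_bij (fun Y _ => pathOf Y) ?_ ?_ ?_ ?_
    · simp
    · exact fun Y _ Y' _ h => pathOf_injective _ h
    · intro x hx
      obtain ⟨Y, rfl⟩ := exists_pathOf_eq (mem_filter.1 hx).2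
      exact ⟨Y, mem_filter.2 ⟨mem_univ _, (mem_filter.1 hx).2⟩, rfl⟩
    · simp
  have h2 := sum_word_init (fun l => wordWeight l peak 0 0 r m (n - r) b a) r
    (2 * (m + n) - r)
  rw [Nat.sub_add_cancel (by omega)] at h2
  rw [h1, wordSum, ← h2, sum_filter]
  refine sum_congr rfl fun Y _ => ?_
  by_cases hY : IsDDb m n r b a (pathOf Y)
  · rw [if_pos hY, if_pos (init_of_isDDb hY), (weight_of_isDDb hY hn).2]
  · rw [if_neg hY]
    split_ifs with hinit
    · by_contra h
      exact hY (isDDb_of_weight hr hrn hinit (Ne.symm h))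
    · rfl

lemma DDbE_zero_run (m n b a : ℤ) (hn : 1 ≤ n) : DDbE m n 0 b a = 0 := by
  rw [DDbE]
  split_ifs
  · refine sum_eq_zero fun x hx => ?_
    have := r_lt_of_isDDb (mem_filter.1 hx).2 (by omega)
    omega
  · rfl

lemma DDbE_eq_wordSum (m n b a : ℤ) {r : ℕ} (hn : 1 ≤ n) (hr : 1 ≤ r) :
    DDbE m n r b a = wordSum ((r : ℤ) + 2 * (m + (n - r))).toNat peak 0 0 r m (n - r) b a := by
  by_cases hneg : m < 0 ∨ b < 0 ∨ a < 0
  · rw [DDbE, if_neg (by omega), wordSum_eq_zero _ _ _ _ _ _ _ _ _ (by omega)]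
  rw [DDbE, if_pos (by omega), Int.toNat_natCast]
  lift m to ℕ using by omega
  lift n to ℕ using by omega
  lift b to ℕ using by omega
  lift a to ℕ using by omega
  simp only [Int.toNat_natCast]
  rcases le_or_gt r n with hrn | hrn
  · rw [sum_isDDb (by omega) hr hrn]
    congr 1
    omega
  · rw [wordSum_eq_zero _ _ _ _ _ _ _ _ _ (by omega)]
    refine sum_eq_zero fun x hx => ?_
    obtain ⟨Y, rfl⟩ := exists_pathOf_eq (mem_filter.1 hx).2
    have := (weight_of_isDDb (mem_filter.1 hx).2 (by omega)).1
    omega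

lemma touchSum_eq_DDbE (m n b a : ℤ) {r : ℕ} (hn : 1 ≤ n) (hr : 1 ≤ r) :
    touchSum r m (n - r) b a = tv ^ (n - r - a + m).toNat * DDbE m n r b a := by
  rw [DDbE_eq_wordSum m n b a hn hr, touchSum, wordSum_peak_touch _ 1 _ _ _ _ _ hr,
    wordSum_peak_touch _ 0 _ _ _ _ _ hr, wordSum_succ_label _ _ _ _ _ _ _ _ _ le_rfl]

lemma DDbE_eq_slotSum (m n b a : ℤ) {r M : ℕ} (hr : 1 ≤ r) (hrn : r < n) (hm : m < M)
    (hn : n < M) :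
    DDbE m n r b a = slotSum M r fun j s => slotSum M (s + j) fun u v =>
      tv ^ u * touchSum (u + v) (m - j) (n - r - u - v) (b - r + s) (a - v) := by
  have h := (wordSum_eq_bounceSum M ((r : ℤ) + 2 * (m + (n - r))).toNat r 0 m (n - r) b a)
  by_cases hneg : m < 0
  · rw [DDbE, if_neg (by omega)]
    exact (slotSum_eq_zero _ _ fun j s => slotSum_eq_zero _ _ fun u v => by
      rw [touchSum_eq_zero _ (by omega), mul_zero]).symm
  rw [DDbE_eq_wordSum m n b a (by omega) hr, wordSum_peak_touch _ _ _ _ _ _ _ hr]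
  refine ((h (by omega) (by omega) hm (by omega) (by omega)).1.trans ?_)
  rw [bounceSum]
  refine slotSum_congr _ _ fun j s => ?_
  simp [runSum]

lemma slotSum_eq_sum (M A e : ℕ) (f : ℕ → ℕ → R2) (hA : A < M) (he : e < M)
    (hf : ∀ j s, A < j → f j s = 0) :
    slotSum M e f = ∑ j ∈ range (A + 1), ∑ s ∈ range (e + 1), slotGF e j s * f j s := by
  symm
  refine (sum_subset (range_mono hA) fun j _ hj => sum_eq_zero fun s _ => ?_).trans
    (sum_congr rfl fun j _ => sum_subset (range_mono he) fun s _ hs => ?_)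
  · rw [hf j s (by simpa using hj), mul_zero]
  · rw [slotGF_eq_zero (by simpa using hs), zero_mul]

lemma qBinomZ_natCast (N k : ℕ) : qBinomZ N k = qBinom N k := by
  rw [qBinomZ]
  split_ifs with h
  · simp
  · rw [qBinom_eq_zero_of_lt (by omega)]

lemma qBinomZ_sub_one (e j : ℕ) (he : 1 ≤ e) : qBinomZ ((e : ℤ) + j - 1) j = qMulti e j := by
  obtain ⟨e, rfl⟩ := Nat.exists_eq_add_of_le' he
  rw [show ((e + 1 : ℕ) : ℤ) + j - 1 = ((e + j : ℕ) : ℤ) by push_cast; ring, qBinomZ_natCast]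
  rfl

lemma slotGF_eq (e j s : ℕ) (he : 1 ≤ e ∨ 1 ≤ j) :
    slotGF e j s =
      qv ^ (s * (s - 1) / 2) * qBinomZ e s * qBinomZ ((e : ℤ) + j - 1) j := by
  rw [slotGF, qSubset, qBinomZ_natCast]
  rcases Nat.eq_zero_or_pos e with rfl | h
  · obtain ⟨j, rfl⟩ := Nat.exists_eq_add_of_le' (he.resolve_left (by omega))
    rw [qBinomZ, if_neg (by omega)]
    rfl
  · rw [qBinomZ_sub_one e j h]

lemma touchSum_zero_run {m n b a : ℤ} (hn : 1 ≤ n) : touchSum 0 m n b a = 0 := by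
  by_cases hneg : m < 0
  · exact touchSum_eq_zero _ (Or.inl hneg)
  · obtain ⟨L, hL⟩ : ∃ L, (((0 : ℕ) : ℤ) + 2 * (m + n)).toNat = L + 1 :=
      Nat.exists_eq_succ_of_ne_zero (by omega)
    rw [touchSum, hL, wordSum_succ]
    simp [Follows]

lemma slotGF_mul_touchSum {m n b a : ℤ} {e u v : ℕ} (hm : 0 ≤ m) (hn : 1 ≤ n)
    (hu : a + u ≤ n) (hv : v ≤ e) :
    slotGF e u v * (tv ^ u * touchSum (u + v) m (n - u - v) b (a - v)) =
      tv ^ (n - a).toNat * tv ^ m.toNat *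
        (qv ^ (v * (v - 1) / 2) * qBinomZ e v * qBinomZ ((e : ℤ) + u - 1) u *
          DDbE m n ((u : ℤ) + v) b (a - v)) := by
  rcases Nat.eq_zero_or_pos (u + v) with h | h
  · obtain ⟨rfl, rfl⟩ : u = 0 ∧ v = 0 := by omega
    rw [touchSum_zero_run (by omega), Nat.cast_zero, add_zero (0 : ℤ), DDbE_zero_run m n _ _ hn]
    simp
  · have h1 := touchSum_eq_DDbE m n b (a - v) hn h
    rw [Nat.cast_add, ← sub_sub] at h1
    rw [slotGF_eq _ _ _ (by omega), h1,
      show (n - a).toNat = u + (n - u - a).toNat by omega,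
      show (n - u - v - (a - v) + m).toNat = (n - u - a).toNat + m.toNat by omega]
    ring

/-- The recursion for the `(area, bounce)` q,t-enumerators of
decorated Dyck paths with decorated falls. -/
theorem DDb_recursion (m a b r n : ℤ)
    (hm : 0 ≤ m) (ha : 0 ≤ a) (hb : 0 ≤ b)
    (hr : 1 ≤ r) (hrn : r < n) (hra : r + a ≤ n) (hbnm : b ≤ n + m) :
    DDbE m n r b a =
      tv ^ (n - r - a).toNat *
        ∑ j ∈ Finset.range (m.toNat + 1), ∑ s ∈ Finset.range (r.toNat + 1),
          qv ^ (s * (s - 1) / 2) * qBinomZ r (s : ℤ) * qBinomZ (r + (j : ℤ) - 1) (j : ℤ) *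
            (tv ^ (m - (j : ℤ)).toNat *
              ∑ u ∈ Finset.range ((n - r - a).toNat + 1), ∑ v ∈ Finset.range (s + j + 1),
                qv ^ (v * (v - 1) / 2) * qBinomZ ((s : ℤ) + (j : ℤ)) (v : ℤ) *
                  qBinomZ ((s : ℤ) + (j : ℤ) + (u : ℤ) - 1) (u : ℤ) *
                    DDbE (m - (j : ℤ)) (n - r) ((u : ℤ) + (v : ℤ))
                      (b - (r - (s : ℤ))) (a - (v : ℤ))) := by
  lift r to ℕ using by omega
  have hM : ∃ M : ℕ, m + n + r < M := ⟨(m + n + r + 1).toNat, by omega⟩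
  obtain ⟨M, hM⟩ := hM
  rw [DDbE_eq_slotSum m n b a (by omega) hrn (show m < M by omega) (by omega),
    slotSum_eq_sum M m.toNat r _ (by omega) (by omega) fun j s hj =>
      slotSum_eq_zero _ _ fun u v => by rw [touchSum_eq_zero _ (by omega), mul_zero],
    mul_sum, Int.toNat_natCast]
  refine sum_congr rfl fun j hj => ?_
  rw [mul_sum]
  refine sum_congr rfl fun s hs => ?_
  rw [mem_range] at hj hs
  rw [slotSum_eq_sum M (n - r - a).toNat (s + j) _ (by omega) (by omega) fun u v hu => by
      rw [touchSum_eq_zero _ (by omega), mul_zero],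
    slotGF_eq r j s (by omega), mul_left_comm]
  congr 1
  rw [← mul_assoc, mul_sum]
  refine sum_congr rfl fun u hu => ?_
  rw [mul_sum]
  refine sum_congr rfl fun v hv => ?_
  rw [mem_range] at hu hv
  rw [slotGF_mul_touchSum (by omega) (by omega) (by omega) (by omega), Nat.cast_add,
    show b - r + s = b - (r - s) by ring]
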